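/- Let T = {T_1, T_2} be a set of two (not necessarily binary) rooted phylogenetic trees on a finite taxa set X and let C = Cl(T). Let p be the MST lower bound for C. Then r(C) = p. -/

import Mathlib

open scoped Classical

namespace Phylo

variable {α : Type} [DecidableEq α]

/-- A finite directed graph whose vertices carry labels from `α`; used to model
rooted phylogenetic networks and trees. -/
structure Net (α : Type) where
  n : ℕ
  E : Finset (Fin n × Fin n)
  label : Fin n → α

namespace Net

def indeg (N : Net α) (v : Fin N.n) : ℕ := (N.E.filter fun e => e.2 = v).card

def outdeg (N : Net α) (v : Fin N.n) : ℕ := (N.E.filter fun e => e.1 = v).card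

def Adj (N : Net α) (u v : Fin N.n) : Prop := (u, v) ∈ N.E

def Reaches (N : Net α) : Fin N.n → Fin N.n → Prop := Relation.ReflTransGen N.Adj

def IsLeaf (N : Net α) (v : Fin N.n) : Prop := N.outdeg v = 0

/-- The set of labels of leaves reachable from `v` by directed paths. -/
noncomputable def clusterBelow (N : Net α) (v : Fin N.n) : Finset α :=
  (Finset.univ.filter fun w => N.Reaches v w ∧ N.IsLeaf w).image N.label

/-- The reticulation number `r(N) = Σ_{v : indeg(v) > 0} (indeg(v) - 1)`. -/
def reticNum (N : Net α) : ℕ := ∑ v, (N.indeg v - 1)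

end Net

/-- `N` is a rooted phylogenetic network on the taxa set `X`: an acyclic digraph with a
unique root (indegree-0 node), no node with indegree 1 and outdegree 1, every
reticulation (indegree ≥ 2) having outdegree ≥ 1, and leaves bijectively labeled by `X`. -/
def IsPhyloNet (X : Finset α) (N : Net α) : Prop :=
  (∀ v : Fin N.n, ¬ Relation.TransGen N.Adj v v) ∧
  (∃! ρ : Fin N.n, N.indeg ρ = 0) ∧
  (∀ v : Fin N.n, ¬ (N.indeg v = 1 ∧ N.outdeg v = 1)) ∧
  (∀ v : Fin N.n, 2 ≤ N.indeg v → 1 ≤ N.outdeg v) ∧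
  Set.BijOn N.label {v | N.IsLeaf v} (X : Set α)

/-- A rooted phylogenetic tree on `X` is a network on `X` with reticulation number 0. -/
def IsPhyloTree (X : Finset α) (N : Net α) : Prop := IsPhyloNet X N ∧ N.reticNum = 0

/-- A network is binary if every reticulation has indegree 2 and outdegree 1 and every
non-leaf tree node has outdegree 2. -/
def IsBinary (N : Net α) : Prop :=
  ∀ v : Fin N.n, (N.indeg v ≤ 1 → N.outdeg v = 0 ∨ N.outdeg v = 2) ∧
    (2 ≤ N.indeg v → N.indeg v = 2 ∧ N.outdeg v = 1)

/-- The internal vertices of a path given as a list of vertices. -/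
def internals {β : Type*} (p : List β) : List β := p.tail.dropLast

def IsDirPath (N : Net α) (u v : Fin N.n) (p : List (Fin N.n)) : Prop :=
  p.head? = some u ∧ p.getLast? = some v ∧ p.Chain' N.Adj ∧ 2 ≤ p.length

/-- `N` displays `T`: `T` can be obtained from `N` by deleting nodes and edges and
suppressing indegree-1 outdegree-1 nodes, formalized as a topological embedding:
each edge of `T` maps to a directed path of `N`, paths being internally disjoint
from each other and from the images of the nodes of `T`, and leaves of `T` map to
leaves of `N` with the same label. -/
def Displays (N T : Net α) : Prop :=
  ∃ φ : Fin T.n → Fin N.n, Function.Injective φ ∧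
    (∀ v, T.IsLeaf v → N.IsLeaf (φ v) ∧ N.label (φ v) = T.label v) ∧
    ∃ P : Fin T.n × Fin T.n → List (Fin N.n),
      (∀ e ∈ T.E, IsDirPath N (φ e.1) (φ e.2) (P e)) ∧
      (∀ e ∈ T.E, ∀ w ∈ internals (P e), w ∉ Set.range φ) ∧
      (∀ e ∈ T.E, ∀ f ∈ T.E, e ≠ f → ∀ w ∈ internals (P e), w ∉ internals (P f))

/-- `N` represents the cluster `C` in the softwired sense: some tree on `X` displayed by
`N` has an edge whose set of leaf descendants is exactly `C`. -/
def RepresentsCluster (X : Finset α) (N : Net α) (C : Finset α) : Prop :=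
  ∃ T : Net α, IsPhyloTree X T ∧ Displays N T ∧ ∃ e ∈ T.E, T.clusterBelow e.2 = C

def RepresentsSet (X : Finset α) (N : Net α) (𝒞 : Set (Finset α)) : Prop :=
  ∀ C ∈ 𝒞, RepresentsCluster X N C

/-- `Cl(T)`: the set of clusters represented by edges of the tree `T`. -/
def clSet (T : Net α) : Set (Finset α) := {C | ∃ e ∈ T.E, T.clusterBelow e.2 = C}

/-- `r(𝒞)`: the minimum reticulation number of a network on `X` representing `𝒞`. -/
noncomputable def rNum (X : Finset α) (𝒞 : Set (Finset α)) : ℕ :=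
  sInf {k | ∃ N : Net α, IsPhyloNet X N ∧ RepresentsSet X N 𝒞 ∧ N.reticNum = k}

/-- A cluster on `X` is a nonempty proper subset of `X`. -/
def IsCluster (X C : Finset α) : Prop := C ⊆ X ∧ C.Nonempty ∧ C ≠ X

def IsClusterSet (X : Finset α) (𝒞 : Set (Finset α)) : Prop := ∀ C ∈ 𝒞, IsCluster X C

def Compatible (A B : Finset α) : Prop := A ∩ B = ∅ ∨ A ⊆ B ∨ B ⊆ A

/-- `𝒞 \ S`: remove the elements of `S` from each cluster, discarding emptied clusters. -/
def removeTaxa (𝒞 : Set (Finset α)) (S : Finset α) : Set (Finset α) :=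
  {D | D.Nonempty ∧ ∃ C ∈ 𝒞, D = C \ S}

/-- `𝒞 | S`: the restriction of `𝒞` to `S`. -/
def restrictTo (𝒞 : Set (Finset α)) (S : Finset α) : Set (Finset α) :=
  {D | D.Nonempty ∧ ∃ C ∈ 𝒞, D = C ∩ S}

/-- `S` is unseparated by `𝒞`: no cluster of `𝒞` is incompatible with `S`. -/
def Unseparated (𝒞 : Set (Finset α)) (S : Finset α) : Prop := ∀ C ∈ 𝒞, Compatible C S

/-- `𝒞` separates every proper subset of `X` with at least two elements. -/
def Separating (X : Finset α) (𝒞 : Set (Finset α)) : Prop :=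
  ∀ X' : Finset α, X' ⊂ X → 2 ≤ X'.card → ∃ C ∈ 𝒞, ¬ Compatible C X'

def PairwiseCompatible (𝒞 : Set (Finset α)) : Prop := ∀ A ∈ 𝒞, ∀ B ∈ 𝒞, Compatible A B

/-- `S` is an ST-set with respect to `𝒞`. -/
def IsSTSet (X : Finset α) (𝒞 : Set (Finset α)) (S : Finset α) : Prop :=
  S ⊆ X ∧ Unseparated 𝒞 S ∧ PairwiseCompatible (restrictTo 𝒞 S)

/-- `S` is a maximal ST-set: no ST-set properly contains it. -/
def IsMaxSTSet (X : Finset α) (𝒞 : Set (Finset α)) (S : Finset α) : Prop :=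
  IsSTSet X 𝒞 S ∧ ∀ S', IsSTSet X 𝒞 S' → ¬ S ⊂ S'

/-- `(S₁, …, S_p)` is a maximal ST-set sequence of `𝒞`. -/
def IsMaxSTSeq : Finset α → Set (Finset α) → List (Finset α) → Prop
  | _, _, [] => True
  | X, 𝒞, S :: L => IsMaxSTSet X 𝒞 S ∧ IsMaxSTSeq (X \ S) (removeTaxa 𝒞 S) L

/-- `(S₁, …, S_p)` is an ST-set sequence of `𝒞` (empty ST-sets allowed). -/
def IsSTSeq : Finset α → Set (Finset α) → List (Finset α) → Prop
  | _, _, [] => True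
  | X, 𝒞, S :: L => IsSTSet X 𝒞 S ∧ IsSTSeq (X \ S) (removeTaxa 𝒞 S) L

def removeAll (𝒞 : Set (Finset α)) (L : List (Finset α)) : Set (Finset α) :=
  L.foldl removeTaxa 𝒞

/-- A maximal ST-set *tree* sequence: additionally the remaining clusters are pairwise
compatible. -/
def IsMaxSTTreeSeq (X : Finset α) (𝒞 : Set (Finset α)) (L : List (Finset α)) : Prop :=
  IsMaxSTSeq X 𝒞 L ∧ PairwiseCompatible (removeAll 𝒞 L)

def IsSTTreeSeq (X : Finset α) (𝒞 : Set (Finset α)) (L : List (Finset α)) : Prop :=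
  IsSTSeq X 𝒞 L ∧ PairwiseCompatible (removeAll 𝒞 L)

/-- The MST lower bound: minimum length of a maximal ST-set tree sequence of `𝒞`. -/
noncomputable def mstLB (X : Finset α) (𝒞 : Set (Finset α)) : ℕ :=
  sInf {p | ∃ L, IsMaxSTTreeSeq X 𝒞 L ∧ L.length = p}

/- Underlying undirected notions, biconnected components and the level of a network. -/

def uadj (N : Net α) (F : Finset (Fin N.n × Fin N.n)) (u v : Fin N.n) : Prop :=
  (u, v) ∈ F ∨ (v, u) ∈ F

def verts (N : Net α) (F : Finset (Fin N.n × Fin N.n)) : Finset (Fin N.n) :=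
  F.image Prod.fst ∪ F.image Prod.snd

def ConnOn (N : Net α) (F : Finset (Fin N.n × Fin N.n)) : Prop :=
  ∀ u ∈ verts N F, ∀ v ∈ verts N F, Relation.ReflTransGen (uadj N F) u v

def delVert (N : Net α) (F : Finset (Fin N.n × Fin N.n)) (v : Fin N.n) :
    Finset (Fin N.n × Fin N.n) :=
  F.filter fun e => e.1 ≠ v ∧ e.2 ≠ v

def HasCutNodeOn (N : Net α) (F : Finset (Fin N.n × Fin N.n)) : Prop :=
  ∃ v ∈ verts N F, ∃ a ∈ verts N F, ∃ b ∈ verts N F, a ≠ v ∧ b ≠ v ∧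
    ¬ Relation.ReflTransGen (uadj N (delVert N F v)) a b

/-- The (edge set of a) subgraph is biconnected: connected and without cut-nodes. -/
def Biconn (N : Net α) (F : Finset (Fin N.n × Fin N.n)) : Prop :=
  F.Nonempty ∧ ConnOn N F ∧ ¬ HasCutNodeOn N F

/-- `F` is a biconnected component of `N`: a maximal biconnected subgraph. -/
def IsBCC (N : Net α) (F : Finset (Fin N.n × Fin N.n)) : Prop :=
  F ⊆ N.E ∧ Biconn N F ∧ ∀ F', F' ⊆ N.E → Biconn N F' → F ⊆ F' → F' = F

/-- Reticulation number of a biconnected component, indegrees computed within it. -/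
def compRetic (N : Net α) (F : Finset (Fin N.n × Fin N.n)) : ℕ :=
  ∑ v ∈ verts N F, ((F.filter fun e => e.2 = v).card - 1)

/-- The level of `N`: the maximum reticulation number of a biconnected component. -/
noncomputable def level (N : Net α) : ℕ :=
  sSup {k | ∃ F, IsBCC N F ∧ compRetic N F = k}

def IsCutEdge (N : Net α) (e : Fin N.n × Fin N.n) : Prop :=
  e ∈ N.E ∧ ∃ a b : Fin N.n, ¬ Relation.ReflTransGen (uadj N (N.E.erase e)) a b

def IsCutNode (N : Net α) (v : Fin N.n) : Prop :=
  ∃ a b : Fin N.n, a ≠ v ∧ b ≠ v ∧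
    ¬ Relation.ReflTransGen (uadj N (delVert N N.E v)) a b

/-- `N` is simple: removal of any cut-node or cut-edge leaves at most one non-trivial
connected component (all remaining edges lie in a single component). -/
def IsSimpleNet (N : Net α) : Prop :=
  (∀ v : Fin N.n, IsCutNode N v → ∀ f ∈ delVert N N.E v, ∀ g ∈ delVert N N.E v,
      Relation.ReflTransGen (uadj N (delVert N N.E v)) f.1 g.1) ∧
  (∀ e : Fin N.n × Fin N.n, IsCutEdge N e → ∀ f ∈ N.E.erase e, ∀ g ∈ N.E.erase e,
      Relation.ReflTransGen (uadj N (N.E.erase e)) f.1 g.1)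

/-- The non-trivial ST-set `S` is under a cut-edge of `N`: `N` has a cut-edge `(u,v)`
such that the subnetwork rooted at `v` is a tree whose taxa set is `S` and which
represents the cluster set `𝒞 | S`. -/
def UnderCutEdge (𝒞 : Set (Finset α)) (N : Net α) (S : Finset α) : Prop :=
  ∃ e ∈ N.E, IsCutEdge N e ∧ N.clusterBelow e.2 = S ∧
    (∀ w : Fin N.n, N.Reaches e.2 w →
      (N.E.filter fun f => f.2 = w ∧ N.Reaches e.2 f.1).card ≤ 1) ∧
    ∀ C ∈ restrictTo 𝒞 S, ∃ f ∈ N.E, N.Reaches e.2 f.1 ∧ N.clusterBelow f.2 = C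

/-- The subnetwork of `N` rooted at `v` is exactly (isomorphic to) `T`. -/
def IsoSubnetAt (N : Net α) (v : Fin N.n) (T : Net α) : Prop :=
  ∃ g : Fin T.n → Fin N.n, Function.Injective g ∧
    Set.range g = {w | N.Reaches v w} ∧
    (∀ a b : Fin T.n, (a, b) ∈ T.E ↔ (g a, g b) ∈ N.E) ∧
    ∀ a : Fin T.n, T.IsLeaf a → N.label (g a) = T.label a

/-- `T` is a subtree below a reticulation (SBR) of `N`. -/
def IsSBR (N T : Net α) : Prop :=
  ∃ v : Fin N.n, 2 ≤ N.indeg v ∧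
    (∀ w : Fin N.n, N.Reaches v w → w ≠ v → N.indeg w < 2) ∧
    ((N.outdeg v = 1 ∧ ∃ c : Fin N.n, (v, c) ∈ N.E ∧ IsoSubnetAt N c T) ∨
     (N.outdeg v ≠ 1 ∧ IsoSubnetAt N v T))

/-- `T'` is a (not necessarily binary) refinement of `T`: a tree on `X` with
`Cl(T) ⊆ Cl(T')`. -/
def IsRefinement (X : Finset α) (T T' : Net α) : Prop :=
  IsPhyloTree X T' ∧ clSet T ⊆ clSet T'

/-- `h⁰(𝒯)`: minimum reticulation number of a network on `X` displaying some
refinement of each tree of the family. -/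
noncomputable def h0 (X : Finset α) {m : ℕ} (T : Fin m → Net α) : ℕ :=
  sInf {k | ∃ N : Net α, IsPhyloNet X N ∧
    (∀ i, ∃ T', IsRefinement X (T i) T' ∧ Displays N T') ∧ N.reticNum = k}

/-- `h⁻(𝒯)`: minimum reticulation number of a network on `X` displaying some *binary*
refinement of each tree of the family. -/
noncomputable def hminus (X : Finset α) {m : ℕ} (T : Fin m → Net α) : ℕ :=
  sInf {k | ∃ N : Net α, IsPhyloNet X N ∧
    (∀ i, ∃ T', IsRefinement X (T i) T' ∧ IsBinary T' ∧ Displays N T') ∧ N.reticNum = k}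

/-- `N` is consistent with the rooted triplet `xy|z`: it displays the binary tree on
`{x,y,z}` in which `{x,y}` is a cluster. -/
def ConsistentTriplet (N : Net α) (x y z : α) : Prop :=
  ∃ t : Net α, IsPhyloTree ({x, y, z} : Finset α) t ∧ IsBinary t ∧
    (∃ e ∈ t.E, t.clusterBelow e.2 = ({x, y} : Finset α)) ∧ Displays N t

/-- `r_tr(𝒯)`: minimum reticulation number of a network on `X` consistent with every
rooted triplet consistent with some tree of the family. -/
noncomputable def rtr (X : Finset α) {m : ℕ} (T : Fin m → Net α) : ℕ :=
  sInf {k | ∃ N : Net α, IsPhyloNet X N ∧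
    (∀ x y z : α, x ≠ y → y ≠ z → x ≠ z →
      (∃ i, ConsistentTriplet (T i) x y z) → ConsistentTriplet N x y z) ∧
    N.reticNum = k}

/-- `𝒞_{U → u}`: replace all elements of `U` in every cluster by the single taxon `u`. -/
def collapseTo (𝒞 : Set (Finset α)) (U : Finset α) (u : α) : Set (Finset α) :=
  {D | ∃ C ∈ 𝒞, D = if (C ∩ U).Nonempty then (C \ U) ∪ {u} else C}

section
set_option linter.unusedSectionVars false
/-! ### Part A: set combinatorics -/

theorem removeTaxa_removeTaxa (𝒞 : Set (Finset α)) (S A : Finset α) :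
    removeTaxa (removeTaxa 𝒞 S) A = removeTaxa 𝒞 (S ∪ A) := by
  ext D
  constructor
  · rintro ⟨hD, C, ⟨hC, C', hC', rfl⟩, rfl⟩
    exact ⟨hD, C', hC', by ext x; simp; tauto⟩
  · rintro ⟨hD, C, hC, rfl⟩
    have he : C \ (S ∪ A) = (C \ S) \ A := by ext x; simp; tauto
    refine ⟨hD, C \ S, ⟨?_, C, hC, rfl⟩, he⟩
    rw [he] at hD
    exact hD.mono Finset.sdiff_subset

theorem Compatible.sdiff {A B : Finset α} (h : Compatible A B) (S : Finset α) :
    Compatible (A \ S) (B \ S) := by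
  rcases h with h | h | h
  · left
    ext x
    have := Finset.ext_iff.1 h x
    simp at this ⊢
    tauto
  · exact Or.inr (Or.inl (Finset.sdiff_subset_sdiff h le_rfl))
  · exact Or.inr (Or.inr (Finset.sdiff_subset_sdiff h le_rfl))

theorem Compatible.symm {A B : Finset α} (h : Compatible A B) : Compatible B A := by
  rcases h with h | h | h
  · left; rwa [Finset.inter_comm]
  · exact Or.inr (Or.inr h)
  · exact Or.inr (Or.inl h)

theorem PairwiseCompatible.removeTaxa {𝒞 : Set (Finset α)} (h : PairwiseCompatible 𝒞)
    (S : Finset α) : PairwiseCompatible (removeTaxa 𝒞 S) := by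
  rintro _ ⟨_, A, hA, rfl⟩ _ ⟨_, B, hB, rfl⟩
  exact (h A hA B hB).sdiff S

theorem IsSTSet.sdiff {X : Finset α} {𝒞 : Set (Finset α)} {S : Finset α} (h : IsSTSet X 𝒞 S)
    (A : Finset α) : IsSTSet (X \ A) (removeTaxa 𝒞 A) (S \ A) := by
  obtain ⟨h1, h2, h3⟩ := h
  refine ⟨Finset.sdiff_subset_sdiff h1 le_rfl, ?_, ?_⟩
  · rintro _ ⟨_, C, hC, rfl⟩
    exact (h2 C hC).sdiff A
  · rintro _ ⟨n1, _, ⟨_, C, hC, rfl⟩, rfl⟩ _ ⟨n2, _, ⟨_, D, hD, rfl⟩, rfl⟩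
    have e : ∀ C : Finset α, C \ A ∩ (S \ A) = (C ∩ S) \ A := by
      intro C; ext x; simp; tauto
    rw [e] at n1 n2
    rw [e, e]
    exact (h3 _ ⟨n1.mono Finset.sdiff_subset, C, hC, rfl⟩ _
      ⟨n2.mono Finset.sdiff_subset, D, hD, rfl⟩).sdiff A

theorem IsSTSeq.sdiff (A : Finset α) : ∀ (L : List (Finset α)) (X : Finset α)
    (𝒞 : Set (Finset α)), IsSTSeq X 𝒞 L → IsSTSeq (X \ A) (removeTaxa 𝒞 A) (L.map (· \ A))
  | [], _, _, _ => trivial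
  | S :: L, X, 𝒞, h => by
    refine ⟨h.1.sdiff A, ?_⟩
    have := IsSTSeq.sdiff A L _ _ h.2
    rw [removeTaxa_removeTaxa] at this ⊢
    have e1 : (X \ A) \ (S \ A) = (X \ S) \ A := by ext x; simp; tauto
    have e2 : A ∪ S \ A = S ∪ A := by ext x; simp; tauto
    rw [e1, e2]
    exact this

theorem removeAll_sdiff (A : Finset α) : ∀ (L : List (Finset α)) (𝒞 : Set (Finset α)),
    removeAll (removeTaxa 𝒞 A) (L.map (· \ A)) = removeTaxa (removeAll 𝒞 L) A
  | [], _ => rfl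
  | S :: L, 𝒞 => by
    have := removeAll_sdiff A L (removeTaxa 𝒞 S)
    simp only [removeAll, List.map_cons, List.foldl_cons] at this ⊢
    rw [← this]
    simp only [removeTaxa_removeTaxa]
    congr 2
    ext x; simp; tauto

theorem IsSTTreeSeq.sdiff {X : Finset α} {𝒞 : Set (Finset α)} {L : List (Finset α)}
    (h : IsSTTreeSeq X 𝒞 L) (A : Finset α) :
    IsSTTreeSeq (X \ A) (removeTaxa 𝒞 A) (L.map (· \ A)) := by
  refine ⟨IsSTSeq.sdiff A L X 𝒞 h.1, ?_⟩
  rw [removeAll_sdiff]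
  exact h.2.removeTaxa A

theorem exists_maxST {X : Finset α} {𝒞 : Set (Finset α)} {S : Finset α} (h : IsSTSet X 𝒞 S) :
    ∃ S', S ⊆ S' ∧ IsMaxSTSet X 𝒞 S' := by
  have hne : (X.powerset.filter fun S' => S ⊆ S' ∧ IsSTSet X 𝒞 S').Nonempty :=
    ⟨S, by simp [h, h.1]⟩
  obtain ⟨S', hS', hmax⟩ := Finset.exists_max_image _ Finset.card hne
  simp only [Finset.mem_filter, Finset.mem_powerset] at hS' hmax
  refine ⟨S', hS'.2.1, hS'.2.2, fun S'' h'' hss => ?_⟩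
  have := hmax S'' ⟨h''.1, hS'.2.1.trans hss.1, h''⟩
  exact absurd (Finset.card_lt_card hss) (by omega)

theorem maxify : ∀ (n : ℕ) (L : List (Finset α)) (X : Finset α) (𝒞 : Set (Finset α)),
    L.length = n → IsSTTreeSeq X 𝒞 L → ∃ L', IsMaxSTTreeSeq X 𝒞 L' ∧ L'.length = n
  | 0, L, X, 𝒞, hn, h => by
    obtain rfl := List.length_eq_zero_iff.1 hn
    exact ⟨[], ⟨trivial, h.2⟩, rfl⟩
  | n + 1, [], X, 𝒞, hn, h => by simp at hn
  | n + 1, S :: L, X, 𝒞, hn, h => by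
    obtain ⟨S', hS, hmax⟩ := exists_maxST h.1.1
    have h2 : IsSTTreeSeq (X \ S) (removeTaxa 𝒞 S) L := ⟨h.1.2, h.2⟩
    have h3 := h2.sdiff S'
    rw [removeTaxa_removeTaxa, Finset.union_eq_right.2 hS,
      show (X \ S) \ S' = X \ S' by rw [sdiff_sdiff_left]; exact congrArg _ (Finset.union_eq_right.2 hS)] at h3
    obtain ⟨L', hL', hlen⟩ := maxify n _ _ _ (by simpa using hn) h3
    exact ⟨S' :: L', ⟨⟨hmax, hL'.1⟩, hL'.2⟩, by simp [hlen]⟩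

theorem isSTSet_singleton {X : Finset α} (𝒞 : Set (Finset α)) {x : α} (hx : x ∈ X) :
    IsSTSet X 𝒞 {x} := by
  refine ⟨by simpa using hx, ?_, ?_⟩
  · intro C _
    by_cases h : x ∈ C
    · exact Or.inr (Or.inr (by simpa using h))
    · left; ext y; simp; rintro h2 rfl; exact h h2
  · rintro _ ⟨n1, C, _, rfl⟩ _ ⟨n2, D, _, rfl⟩
    right; left
    intro y hy
    obtain ⟨z, hz⟩ := n2
    simp at hy hz ⊢
    obtain ⟨h1, rfl⟩ := hz
    exact ⟨hy.2 ▸ h1, hy.2⟩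

theorem exists_STTreeSeq : ∀ (n : ℕ) (X : Finset α) (𝒞 : Set (Finset α)), X.card = n →
    (∀ C ∈ 𝒞, C.Nonempty ∧ C ⊆ X) → ∃ L, IsSTTreeSeq X 𝒞 L
  | 0, X, 𝒞, hn, h => by
    refine ⟨[], trivial, ?_⟩
    intro A hA
    obtain rfl := Finset.card_eq_zero.1 hn
    have := h A hA
    rw [Finset.subset_empty] at this
    simp [this.2] at this
  | n + 1, X, 𝒞, hn, h => by
    obtain ⟨x, hx⟩ : X.Nonempty := Finset.card_pos.1 (by omega)
    obtain ⟨L, hL⟩ := exists_STTreeSeq n (X \ {x}) (removeTaxa 𝒞 {x})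
      (by rw [Finset.card_sdiff_of_subset (by simpa using hx)]; simp [hn])
      (by
        rintro _ ⟨hD, C, hC, rfl⟩
        exact ⟨hD, Finset.sdiff_subset_sdiff (h C hC).2 le_rfl⟩)
    exact ⟨{x} :: L, ⟨isSTSet_singleton 𝒞 hx, hL.1⟩, hL.2⟩
end

section
set_option linter.unusedSectionVars false
/-! ### Part B: lower bound -/

theorem rtg_comparable {V : Type} {Q : V → V → Prop} (hQ : ∀ a b c, Q a c → Q b c → a = b)
    {u v w : V} (h1 : Relation.ReflTransGen Q u w) (h2 : Relation.ReflTransGen Q v w) :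
    Relation.ReflTransGen Q u v ∨ Relation.ReflTransGen Q v u := by
  induction h1 with
  | refl => exact Or.inr h2
  | @tail b c hb hbc ih =>
    rcases Relation.ReflTransGen.cases_tail h2 with h | ⟨d, hd, hdc⟩
    · subst h; exact Or.inl (hb.tail hbc)
    · obtain rfl := hQ _ _ _ hbc hdc
      exact ih hd

/-- A choice of parent for every vertex having a parent. -/
structure PQ {V : Type} (A Q : V → V → Prop) : Prop where
  sub : ∀ a b, Q a b → A a b
  uniq : ∀ a b c, Q a c → Q b c → a = b
  tot : ∀ a b, A a b → ∃ c, Q c b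

theorem PQ.mono {V : Type} {A Q : V → V → Prop} (h : PQ A Q) {u v : V}
    (huv : Relation.ReflTransGen Q u v) : Relation.ReflTransGen A u v :=
  Relation.ReflTransGen.mono h.sub _ _ huv

theorem PQ.forced {V : Type} {A Q : V → V → Prop} (h : PQ A Q)
    (hac : ∀ v, ¬ Relation.TransGen A v v) {u y : V} (huy : Relation.ReflTransGen A u y)
    (hf : ∀ z, Relation.ReflTransGen A u z → z ≠ u → Relation.ReflTransGen A z y →
      ∀ a b, A a z → A b z → a = b) : Relation.ReflTransGen Q u y := by
  induction huy with
  | refl => exact .refl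
  | @tail b c hb hbc ih =>
    refine (ih fun z h1 h2 h3 => hf z h1 h2 (h3.tail hbc)).tail ?_
    obtain ⟨d, hd⟩ := h.tot _ _ hbc
    have hcu : c ≠ u := by
      rintro rfl
      exact hac _ (Relation.TransGen.tail' hb hbc)
    rw [hf c (hb.tail hbc) hcu .refl b d hbc (h.sub _ _ hd)]
    exact hd

section LB
variable {V : Type} [Fintype V] (A : V → V → Prop) (hac : ∀ v, ¬ Relation.TransGen A v v)
  (l : α → V)

/-- `v` is a reticulation for the relation. -/
def RetV {V : Type} (A : V → V → Prop) (v : V) : Prop := ∃ a b, A a v ∧ A b v ∧ a ≠ b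

def RepQ {V : Type} (A : V → V → Prop) (l : α → V) (X C : Finset α) : Prop :=
  ∃ Q w, PQ A Q ∧ ∀ x, x ∈ C ↔ x ∈ X ∧ Relation.ReflTransGen Q w (l x)

include hac in
omit [Fintype V] in
theorem compat_forced {X C D : Finset α} {Q1 Q2 : V → V → Prop} {w1 w2 : V}
    (h1 : PQ A Q1) (h2 : PQ A Q2)
    (hf1 : ∀ z, Relation.ReflTransGen A w1 z → z ≠ w1 → ∀ x ∈ X, Relation.ReflTransGen A z (l x) →
      ¬ RetV A z)
    (hf2 : ∀ z, Relation.ReflTransGen A w2 z → z ≠ w2 → ∀ x ∈ X, Relation.ReflTransGen A z (l x) →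
      ¬ RetV A z)
    (hC : ∀ x, x ∈ C ↔ x ∈ X ∧ Relation.ReflTransGen Q1 w1 (l x))
    (hD : ∀ x, x ∈ D ↔ x ∈ X ∧ Relation.ReflTransGen Q2 w2 (l x)) : Compatible C D := by
  have e1 : ∀ Q, PQ A Q → ∀ x ∈ X, Relation.ReflTransGen A w1 (l x) →
      Relation.ReflTransGen Q w1 (l x) := by
    intro Q hQ x hx hr
    refine hQ.forced hac hr fun z a b c p q hp hq => ?_
    by_contra hne
    exact hf1 z a b x hx c ⟨p, q, hp, hq, hne⟩
  have e2 : ∀ Q, PQ A Q → ∀ x ∈ X, Relation.ReflTransGen A w2 (l x) →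
      Relation.ReflTransGen Q w2 (l x) := by
    intro Q hQ x hx hr
    refine hQ.forced hac hr fun z a b c p q hp hq => ?_
    by_contra hne
    exact hf2 z a b x hx c ⟨p, q, hp, hq, hne⟩
  by_cases hdis : C ∩ D = ∅
  · exact Or.inl hdis
  right
  obtain ⟨x, hx⟩ := Finset.nonempty_iff_ne_empty.2 hdis
  rw [Finset.mem_inter, hC, hD] at hx
  obtain ⟨⟨hxX, hx1⟩, -, hx2⟩ := hx
  rcases rtg_comparable h1.uniq hx1 (e2 Q1 h1 x hxX (h2.mono hx2)) with h | h
  · right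
    intro y hy
    rw [hD] at hy; rw [hC]
    exact ⟨hy.1, e1 _ h1 _ hy.1 ((h1.mono h).trans (h2.mono hy.2))⟩
  · left
    intro y hy
    rw [hC] at hy; rw [hD]
    exact ⟨hy.1, e2 _ h2 _ hy.1 ((h1.mono h).trans (h1.mono hy.2))⟩

include hac in
omit [Fintype V] in
theorem LB_step {X : Finset α} {𝒞 : Set (Finset α)} {v : V}
    (hv : ∀ z, Relation.ReflTransGen A v z → z ≠ v → ∀ x ∈ X, Relation.ReflTransGen A z (l x) →
      ¬ RetV A z) (h𝒞 : ∀ C ∈ 𝒞, RepQ A l X C) :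
    IsSTSet X 𝒞 (X.filter fun x => Relation.ReflTransGen A v (l x)) := by
  have key : ∀ Q, PQ A Q → ∀ x ∈ X, Relation.ReflTransGen A v (l x) →
      Relation.ReflTransGen Q v (l x) := by
    intro Q hQ x hx hr
    refine hQ.forced hac hr fun z a b c p q hp hq => ?_
    by_contra hne
    exact hv z a b x hx c ⟨p, q, hp, hq, hne⟩
  have tri : ∀ C Q w, PQ A Q → (∀ x, x ∈ C ↔ x ∈ X ∧ Relation.ReflTransGen Q w (l x)) →
      (C ∩ X.filter fun x => Relation.ReflTransGen A v (l x)).Nonempty →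
      (X.filter fun x => Relation.ReflTransGen A v (l x)) ⊆ C ∨ Relation.ReflTransGen A v w := by
    rintro C Q w hQ hC ⟨x, hx⟩
    simp only [Finset.mem_inter, hC, Finset.mem_filter] at hx
    rcases rtg_comparable hQ.uniq hx.1.2 (key Q hQ x hx.1.1 hx.2.2) with h | h
    · left
      intro y hy
      rw [Finset.mem_filter] at hy
      rw [hC]
      exact ⟨hy.1, h.trans (key Q hQ y hy.1 hy.2)⟩
    · exact Or.inr (hQ.mono h)
  refine ⟨Finset.filter_subset _ _, ?_, ?_⟩
  · intro C hC
    obtain ⟨Q, w, hQ, hC'⟩ := h𝒞 C hC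
    by_cases hne : (C ∩ X.filter fun x => Relation.ReflTransGen A v (l x)) = ∅
    · exact Or.inl hne
    rcases tri C Q w hQ hC' (Finset.nonempty_iff_ne_empty.2 hne) with h | h
    · exact Or.inr (Or.inr h)
    · right; left
      intro y hy
      rw [hC'] at hy
      rw [Finset.mem_filter]
      exact ⟨hy.1, h.trans (hQ.mono hy.2)⟩
  · rintro _ ⟨n1, C, hC, rfl⟩ _ ⟨n2, D, hD, rfl⟩
    obtain ⟨Q1, w1, hQ1, hC'⟩ := h𝒞 C hC
    obtain ⟨Q2, w2, hQ2, hD'⟩ := h𝒞 D hD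
    rcases tri C Q1 w1 hQ1 hC' n1 with h1 | h1
    · exact Or.inr (Or.inr (Finset.subset_inter (Finset.inter_subset_right.trans h1)
        Finset.inter_subset_right))
    rcases tri D Q2 w2 hQ2 hD' n2 with h2 | h2
    · exact Or.inr (Or.inl (Finset.subset_inter (Finset.inter_subset_right.trans h2)
        Finset.inter_subset_right))
    have sh : ∀ w, Relation.ReflTransGen A v w → ∀ z, Relation.ReflTransGen A w z → z ≠ w →
        ∀ x ∈ X, Relation.ReflTransGen A z (l x) → ¬ RetV A z := by
      intro w hw z hz hne x hx hzx
      refine hv z (hw.trans hz) ?_ x hx hzx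
      rintro rfl
      rcases Relation.reflTransGen_iff_eq_or_transGen.1 hz with h | h
      · exact hne h
      · exact hac _ (Relation.TransGen.trans_right hw h)
    have := compat_forced A hac l hQ1 hQ2 (sh w1 h1) (sh w2 h2) hC' hD'
    rcases this with h | h | h
    · left
      ext x
      have := Finset.ext_iff.1 h x
      simp at this ⊢
      tauto
    · exact Or.inr (Or.inl (Finset.inter_subset_inter h le_rfl))
    · exact Or.inr (Or.inr (Finset.inter_subset_inter h le_rfl))

include hac in
theorem LB_main : ∀ (n : ℕ) (R : Finset V) (X : Finset α) (𝒞 : Set (Finset α)), R.card = n →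
    (∀ v, RetV A v → ∀ x ∈ X, Relation.ReflTransGen A v (l x) → v ∈ R) →
    (∀ C ∈ 𝒞, RepQ A l X C) → ∃ L, IsSTTreeSeq X 𝒞 L ∧ L.length = n
  | 0, R, X, 𝒞, hn, hR, h𝒞 => by
    obtain rfl := Finset.card_eq_zero.1 hn
    refine ⟨[], ⟨trivial, ?_⟩, rfl⟩
    intro C hC D hD
    obtain ⟨Q1, w1, hQ1, hC'⟩ := h𝒞 C hC
    obtain ⟨Q2, w2, hQ2, hD'⟩ := h𝒞 D hD
    exact compat_forced A hac l hQ1 hQ2 (fun z _ _ x hx hr hv => by simpa using hR z hv x hx hr)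
      (fun z _ _ x hx hr hv => by simpa using hR z hv x hx hr) hC' hD'
  | n + 1, R, X, 𝒞, hn, hR, h𝒞 => by
    have hne : R.Nonempty := Finset.card_pos.1 (by omega)
    obtain ⟨v, hvR, hmin⟩ := Finset.exists_min_image R
      (fun v => (Finset.univ.filter fun z => Relation.ReflTransGen A v z).card) hne
    have hv : ∀ z ∈ R, Relation.ReflTransGen A v z → z = v := by
      intro z hz hvz
      by_contra hzv
      have h1 := hmin z hz
      have : (Finset.univ.filter fun y => Relation.ReflTransGen A z y) ⊂
          (Finset.univ.filter fun y => Relation.ReflTransGen A v y) := by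
        rw [Finset.ssubset_iff_of_subset]
        · refine ⟨v, by simp [Relation.ReflTransGen.refl], ?_⟩
          simp only [Finset.mem_filter, Finset.mem_univ, true_and]
          intro h
          rcases Relation.reflTransGen_iff_eq_or_transGen.1 h with h | h
          · exact hzv h.symm
          · exact hac _ (Relation.TransGen.trans_left h hvz)
        · intro y hy
          simp only [Finset.mem_filter, Finset.mem_univ, true_and] at hy ⊢
          exact hvz.trans hy
      exact absurd (Finset.card_lt_card this) (by omega)
    have hST := LB_step A hac l (X := X) (𝒞 := 𝒞) (v := v)
      (fun z h1 h2 x hx hr hret => h2 (hv z (hR z hret x hx hr) h1)) h𝒞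
    set S := X.filter fun x => Relation.ReflTransGen A v (l x) with hS
    obtain ⟨L, hL, hlen⟩ := LB_main n (R.erase v) (X \ S) (removeTaxa 𝒞 S)
      (by rw [Finset.card_erase_of_mem hvR]; omega)
      (by
        intro z hz x hx hr
        rw [Finset.mem_sdiff] at hx
        refine Finset.mem_erase.2 ⟨?_, hR z hz x hx.1 hr⟩
        rintro rfl
        exact hx.2 (Finset.mem_filter.2 ⟨hx.1, hr⟩))
      (by
        rintro _ ⟨_, C, hC, rfl⟩
        obtain ⟨Q, w, hQ, hC'⟩ := h𝒞 C hC
        refine ⟨Q, w, hQ, fun x => ?_⟩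
        rw [Finset.mem_sdiff, Finset.mem_sdiff, hC']
        tauto)
    exact ⟨S :: L, ⟨⟨hST, hL.1⟩, hL.2⟩, by simp [hlen]⟩

end LB
end

section
set_option linter.unusedSectionVars false
/-! ### Basic facts about nets -/

theorem indeg_eq_zero {N : Net α} {v : Fin N.n} : N.indeg v = 0 ↔ ∀ u, ¬ N.Adj u v := by
  simp only [Net.indeg, Finset.card_eq_zero, Finset.filter_eq_empty_iff, Net.Adj]
  constructor
  · intro h u hu; exact h hu rfl
  · rintro h ⟨a, b⟩ he rfl; exact h a he

theorem outdeg_eq_zero {N : Net α} {v : Fin N.n} : N.outdeg v = 0 ↔ ∀ u, ¬ N.Adj v u := by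
  simp only [Net.outdeg, Finset.card_eq_zero, Finset.filter_eq_empty_iff, Net.Adj]
  constructor
  · intro h u hu; exact h hu rfl
  · rintro h ⟨a, b⟩ he rfl; exact h b he

theorem indeg_le_one {N : Net α} {v : Fin N.n} :
    N.indeg v ≤ 1 ↔ ∀ a b, N.Adj a v → N.Adj b v → a = b := by
  simp only [Net.indeg, Finset.card_le_one, Finset.mem_filter, Net.Adj]
  constructor
  · intro h a b ha hb
    exact congrArg Prod.fst (h (a, v) ⟨ha, rfl⟩ (b, v) ⟨hb, rfl⟩)
  · rintro h ⟨a, v⟩ ⟨ha, rfl⟩ ⟨b, w⟩ ⟨hb, h'⟩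
    simp only at h' hb
    subst h'
    rw [h a b ha hb]

theorem outdeg_le_one {N : Net α} {v : Fin N.n} :
    N.outdeg v ≤ 1 ↔ ∀ a b, N.Adj v a → N.Adj v b → a = b := by
  simp only [Net.outdeg, Finset.card_le_one, Finset.mem_filter, Net.Adj]
  constructor
  · intro h a b ha hb
    exact congrArg Prod.snd (h (v, a) ⟨ha, rfl⟩ (v, b) ⟨hb, rfl⟩)
  · rintro h ⟨v, a⟩ ⟨ha, rfl⟩ ⟨w, b⟩ ⟨hb, h'⟩
    simp only at h' hb
    subst h'
    rw [h a b ha hb]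

theorem tree_uniq {X : Finset α} {T : Net α} (h : IsPhyloTree X T) (a b v : Fin T.n)
    (ha : T.Adj a v) (hb : T.Adj b v) : a = b := by
  have h2 := h.2
  unfold Net.reticNum at h2
  rw [Finset.sum_eq_zero_iff] at h2
  have := h2 v (Finset.mem_univ _)
  exact indeg_le_one.1 (by omega) a b ha hb

theorem wf_of_acyclic {V : Type} [Finite V] {A : V → V → Prop}
    (hac : ∀ v, ¬ Relation.TransGen A v v) : WellFounded (Relation.TransGen A) := by
  have : Std.Irrefl (Relation.TransGen A) := ⟨hac⟩
  exact Finite.wellFounded_of_trans_of_irrefl _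

theorem wf_swap_of_acyclic {V : Type} [Finite V] {A : V → V → Prop}
    (hac : ∀ v, ¬ Relation.TransGen A v v) :
    WellFounded (Function.swap (Relation.TransGen A)) := by
  have : Std.Irrefl (Function.swap (Relation.TransGen A)) := ⟨hac⟩
  have : IsTrans V (Function.swap (Relation.TransGen A)) := ⟨fun _ _ _ h1 h2 => h2.trans h1⟩
  exact Finite.wellFounded_of_trans_of_irrefl _

theorem root_reaches {X : Finset α} {N : Net α} (h : IsPhyloNet X N) {ρ : Fin N.n}
    (hρ : N.indeg ρ = 0) (v : Fin N.n) : N.Reaches ρ v := by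
  induction v using (wf_of_acyclic h.1).induction with
  | _ v ih =>
    by_cases hv : N.indeg v = 0
    · obtain rfl := h.2.1.unique hρ hv
      exact .refl
    · rw [indeg_eq_zero] at hv
      push Not at hv
      obtain ⟨u, hu⟩ := hv
      exact (ih u (.single hu)).tail hu

theorem reaches_leaf {X : Finset α} {N : Net α} (h : IsPhyloNet X N) (v : Fin N.n) :
    ∃ w, N.Reaches v w ∧ N.IsLeaf w := by
  induction v using (wf_swap_of_acyclic h.1).induction with
  | _ v ih =>
    by_cases hv : N.outdeg v = 0
    · exact ⟨v, .refl, hv⟩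
    · rw [outdeg_eq_zero] at hv
      push Not at hv
      obtain ⟨u, hu⟩ := hv
      obtain ⟨w, h1, h2⟩ := ih u (.single hu)
      exact ⟨w, h1.head hu, h2⟩

theorem mem_clusterBelow {N : Net α} {v : Fin N.n} {x : α} :
    x ∈ N.clusterBelow v ↔ ∃ w, (N.Reaches v w ∧ N.IsLeaf w) ∧ N.label w = x := by
  simp [Net.clusterBelow]

theorem clSet_nonempty_subset {X : Finset α} {T : Net α} (h : IsPhyloNet X T) :
    ∀ C ∈ clSet T, C.Nonempty ∧ C ⊆ X := by
  rintro _ ⟨e, _, rfl⟩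
  constructor
  · obtain ⟨w, h1, h2⟩ := reaches_leaf h e.2
    exact ⟨T.label w, mem_clusterBelow.2 ⟨w, ⟨h1, h2⟩, rfl⟩⟩
  · intro x hx
    obtain ⟨w, h1, rfl⟩ := mem_clusterBelow.1 hx
    exact h.2.2.2.2.mapsTo h1.2

theorem phylo_nonempty {X : Finset α} {N : Net α} (h : IsPhyloNet X N) : X.Nonempty := by
  obtain ⟨ρ, hρ, _⟩ := h.2.1
  obtain ⟨w, h1, h2⟩ := reaches_leaf h ρ
  exact ⟨_, h.2.2.2.2.mapsTo h2⟩

theorem clSet_compatible {X : Finset α} {T : Net α} (h : IsPhyloTree X T) :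
    PairwiseCompatible (clSet T) := by
  rintro _ ⟨e, _, rfl⟩ _ ⟨f, _, rfl⟩
  by_cases hdis : T.clusterBelow e.2 ∩ T.clusterBelow f.2 = ∅
  · exact Or.inl hdis
  right
  obtain ⟨x, hx⟩ := Finset.nonempty_iff_ne_empty.2 hdis
  rw [Finset.mem_inter, mem_clusterBelow, mem_clusterBelow] at hx
  obtain ⟨⟨w, hw, hwx⟩, ⟨w', hw', rfl⟩⟩ := hx
  obtain rfl := h.1.2.2.2.2.injOn hw.2 hw'.2 hwx
  rcases rtg_comparable (tree_uniq h) hw.1 hw'.1 with h | h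
  · right
    intro y hy
    rw [mem_clusterBelow] at hy ⊢
    obtain ⟨z, hz, rfl⟩ := hy
    exact ⟨z, ⟨h.trans hz.1, hz.2⟩, rfl⟩
  · left
    intro y hy
    rw [mem_clusterBelow] at hy ⊢
    obtain ⟨z, hz, rfl⟩ := hy
    exact ⟨z, ⟨h.trans hz.1, hz.2⟩, rfl⟩

/-! ### Paths -/

theorem mem_internals {β : Type} {p : List β} {w : β} :
    w ∈ internals p ↔ ∃ k, 0 < k ∧ k + 1 < p.length ∧ p[k]? = some w := by
  unfold internals
  rw [List.mem_iff_getElem?]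
  constructor
  · rintro ⟨k, hk⟩
    have hl : k < p.tail.dropLast.length := (List.getElem?_eq_some_iff.1 hk).1
    simp only [List.length_dropLast, List.length_tail] at hl
    refine ⟨k + 1, by omega, by omega, ?_⟩
    rw [List.getElem?_dropLast, if_pos (by simp; omega), List.getElem?_tail] at hk
    exact hk
  · rintro ⟨k, h1, h2, h3⟩
    refine ⟨k - 1, ?_⟩
    rw [List.getElem?_dropLast, if_pos (by simp; omega), List.getElem?_tail]
    rw [show k - 1 + 1 = k by omega]
    exact h3

theorem nodup_of_chain {V : Type} {A : V → V → Prop} (hac : ∀ v, ¬ Relation.TransGen A v v)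
    {p : List V} (h : p.IsChain A) : p.Nodup := by
  have h1 : p.IsChain (Relation.TransGen A) := h.imp fun _ _ h => .single h
  rw [List.isChain_iff_pairwise] at h1
  refine h1.imp ?_
  rintro a b hab rfl
  exact hac _ hab

theorem chain_getElem {V : Type} {A : V → V → Prop} {p : List V} (h : p.IsChain A) {k : ℕ} {a b : V}
    (ha : p[k]? = some a) (hb : p[k + 1]? = some b) : A a b := by
  rw [List.getElem?_eq_some_iff] at ha hb
  obtain ⟨_, rfl⟩ := ha
  obtain ⟨hk, rfl⟩ := hb
  exact List.isChain_iff_getElem.1 h k hk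

theorem nodup_idx {V : Type} {p : List V} (h : p.Nodup) {k m : ℕ} {a : V}
    (ha : p[k]? = some a) (hb : p[m]? = some a) : k = m := by
  have hk := (List.getElem?_eq_some_iff.1 ha).1
  exact (List.getElem?_inj hk h).1 (ha.trans hb.symm)

theorem rtg_of_chain {V : Type} {A : V → V → Prop} {p : List V}
    (h : ∀ (k : ℕ) (a b : V), p[k]? = some a → p[k + 1]? = some b → A a b) {u v : V}
    (hu : p.head? = some u) (hv : p.getLast? = some v) : Relation.ReflTransGen A u v := by
  have key : ∀ (k : ℕ) (a : V), p[k]? = some a → Relation.ReflTransGen A u a := by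
    intro k
    induction k with
    | zero => intro a ha; rw [List.head?_eq_getElem?, ha] at hu; simp at hu; subst hu; exact .refl
    | succ k ih =>
      intro a ha
      have hk := (List.getElem?_eq_some_iff.1 ha).1
      exact (ih (p[k]'(by omega)) (by simp)).tail (h k _ _ (by simp) ha)
  rw [List.getLast?_eq_getElem?] at hv
  exact key _ _ hv
end

section
set_option linter.unusedSectionVars false
theorem displays_RepQ {X : Finset α} {N : Net α} (hN : IsPhyloNet X N) {C : Finset α}
    (hC : RepresentsCluster X N C) (l : α → Fin N.n)
    (hl : ∀ x ∈ X, N.IsLeaf (l x) ∧ N.label (l x) = x) : RepQ N.Adj l X C := by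
  obtain ⟨T, hT, ⟨φ, hφ, hleaf, P, hP, hint, hdis⟩, e, he, rfl⟩ := hC
  have hnd : ∀ f ∈ T.E, (P f).Nodup := fun f hf => nodup_of_chain hN.1 (hP f hf).2.2.1
  set Q0 : Fin N.n → Fin N.n → Prop := fun a b =>
    ∃ f ∈ T.E, ∃ k : ℕ, (P f)[k]? = some a ∧ (P f)[k + 1]? = some b with hQ0
  -- position of a non-initial vertex
  have pos : ∀ f ∈ T.E, ∀ (k : ℕ) b, (P f)[k + 1]? = some b →
      b ∈ internals (P f) ∨ b = φ f.2 := by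
    intro f hf k b hb
    have hk := (List.getElem?_eq_some_iff.1 hb).1
    by_cases hk2 : k + 1 + 1 < (P f).length
    · exact Or.inl (mem_internals.2 ⟨k + 1, by omega, hk2, hb⟩)
    · right
      have := (hP f hf).2.1
      rw [List.getLast?_eq_getElem?, show (P f).length - 1 = k + 1 by omega, hb] at this
      simpa using this
  have same : ∀ f ∈ T.E, ∀ g ∈ T.E, ∀ (k m : ℕ) b, (P f)[k + 1]? = some b →
      (P g)[m + 1]? = some b → f = g := by
    intro f hf g hg k m b hk hm
    rcases pos f hf k b hk with h1 | h1 <;> rcases pos g hg m b hm with h2 | h2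
    · by_contra hne
      exact hdis f hf g hg hne b h1 h2
    · exact absurd ⟨_, h2.symm⟩ (hint f hf b h1)
    · exact absurd ⟨_, h1.symm⟩ (hint g hg b h2)
    · have h3 := hφ (h1.symm.trans h2)
      have : f.1 = g.1 := tree_uniq hT f.1 g.1 f.2 hf (by rw [h3]; exact hg)
      exact Prod.ext this h3
  have Q0sub : ∀ a b, Q0 a b → N.Adj a b := by
    rintro a b ⟨f, hf, k, h1, h2⟩
    exact chain_getElem (hP f hf).2.2.1 h1 h2
  have Q0uniq : ∀ a b c, Q0 a c → Q0 b c → a = b := by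
    rintro a b c ⟨f, hf, k, h1, h2⟩ ⟨g, hg, m, h3, h4⟩
    obtain rfl := same f hf g hg k m c h2 h4
    have := nodup_idx (hnd f hf) h2 h4
    obtain rfl : k = m := by omega
    simpa using h1.symm.trans h3
  set Q : Fin N.n → Fin N.n → Prop := fun a b =>
    Q0 a b ∨ ((∀ c, ¬ Q0 c b) ∧ ∃ h : ∃ c, N.Adj c b, a = h.choose) with hQdef
  have hQ : PQ N.Adj Q := by
    refine ⟨?_, ?_, ?_⟩
    · rintro a b (h | ⟨_, h, rfl⟩)
      · exact Q0sub a b h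
      · exact h.choose_spec
    · rintro a b c (h | ⟨h0, h, rfl⟩) (h' | ⟨h0', h', rfl⟩)
      · exact Q0uniq a b c h h'
      · exact absurd h (h0' a)
      · exact absurd h' (h0 b)
      · rfl
    · intro a b hab
      by_cases h : ∃ c, Q0 c b
      · obtain ⟨c, hc⟩ := h
        exact ⟨c, Or.inl hc⟩
      · push Not at h
        exact ⟨_, Or.inr ⟨h, ⟨a, hab⟩, rfl⟩⟩
  have fwd : ∀ u v, T.Reaches u v → Relation.ReflTransGen Q (φ u) (φ v) := by
    intro u v huv
    induction huv with
    | refl => exact .refl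
    | @tail b c _ hbc ih =>
      refine ih.trans ?_
      exact rtg_of_chain (fun k a d h1 h2 => Or.inl ⟨(b, c), hbc, k, h1, h2⟩)
        (hP _ hbc).1 (hP _ hbc).2.1
  obtain ⟨r, hr, -⟩ := hT.1.2.1
  have key : ∀ t : Fin T.n, ∀ a, Relation.ReflTransGen Q a (φ t) →
      (∃ f ∈ T.E, T.Reaches f.2 t ∧ a ∈ internals (P f)) ∨ (∃ u, a = φ u ∧ T.Reaches u t) ∨
      N.Reaches a (φ r) := by
    intro t a ha
    -- stepping along one path
    have step : ∀ f ∈ T.E, T.Reaches f.2 t → ∀ (k : ℕ) b c, (P f)[k + 1]? = some b → Q c b →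
        (∃ f ∈ T.E, T.Reaches f.2 t ∧ c ∈ internals (P f)) ∨ (∃ u, c = φ u ∧ T.Reaches u t) := by
      intro f hf hft k b c hb hcb
      have hk := (List.getElem?_eq_some_iff.1 hb).1
      have hd : Q ((P f)[k]'(by omega)) b := Or.inl ⟨f, hf, k, by simp, hb⟩
      have hc := hQ.uniq _ _ _ hcb hd
      rcases Nat.eq_zero_or_pos k with rfl | hkpos
      · right
        refine ⟨f.1, ?_, Relation.ReflTransGen.head hf hft⟩
        have := (hP f hf).1
        rw [List.head?_eq_getElem?] at this
        rw [hc]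
        exact (List.getElem?_eq_some_iff.1 this).2
      · left
        exact ⟨f, hf, hft, mem_internals.2 ⟨k, hkpos, hk, by rw [hc]; simp⟩⟩
    induction ha using Relation.ReflTransGen.head_induction_on with
    | refl => exact Or.inr (Or.inl ⟨t, rfl, .refl⟩)
    | @head c b hcb _ ih =>
      rcases ih with ⟨f, hf, hft, hb⟩ | ⟨u, rfl, hu⟩ | h
      · obtain ⟨k, hk0, hk1, hk⟩ := mem_internals.1 hb
        obtain ⟨k, rfl⟩ : ∃ m, k = m + 1 := ⟨k - 1, by omega⟩
        rcases step f hf hft k b c hk hcb with h | h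
        · exact Or.inl h
        · exact Or.inr (Or.inl h)
      · by_cases hur : T.indeg u = 0
        · obtain rfl := hT.1.2.1.unique hr hur
          exact Or.inr (Or.inr (Relation.ReflTransGen.single (hQ.sub _ _ hcb)))
        · rw [indeg_eq_zero] at hur
          push Not at hur
          obtain ⟨p, hp⟩ := hur
          have h2 := (hP _ hp).2.1
          have h3 := (hP _ hp).2.2.2
          rw [List.getLast?_eq_getElem?,
            show (P (p, u)).length - 1 = (P (p, u)).length - 2 + 1 by omega] at h2
          rcases step (p, u) hp hu _ _ c h2 hcb with h | h
          · exact Or.inl h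
          · exact Or.inr (Or.inl h)
      · exact Or.inr (Or.inr (Relation.ReflTransGen.head (hQ.sub _ _ hcb) h))
  have lab : ∀ t, T.IsLeaf t → T.label t ∈ X ∧ φ t = l (T.label t) := by
    intro t ht
    have h1 : T.label t ∈ X := hT.1.2.2.2.2.mapsTo ht
    refine ⟨h1, hN.2.2.2.2.injOn (hleaf t ht).1 (hl _ h1).1 ?_⟩
    rw [(hleaf t ht).2, (hl _ h1).2]
  refine ⟨Q, φ e.2, hQ, fun x => ?_⟩
  rw [mem_clusterBelow]
  constructor
  · rintro ⟨t, ⟨h1, h2⟩, rfl⟩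
    exact ⟨(lab t h2).1, (lab t h2).2 ▸ fwd _ _ h1⟩
  · rintro ⟨hx, h⟩
    obtain ⟨t, ht, rfl⟩ := hT.1.2.2.2.2.surjOn hx
    refine ⟨t, ⟨?_, ht⟩, rfl⟩
    rw [← (lab t ht).2] at h
    rcases key t _ h with ⟨f, hf, _, h2⟩ | ⟨u, h2, h3⟩ | h2
    · exact absurd ⟨_, rfl⟩ (hint f hf _ h2)
    · rwa [hφ h2]
    · have h3 : N.Reaches (φ r) (φ e.2) := hQ.mono (fwd _ _ (root_reaches hT.1 hr e.2))
      rcases Relation.reflTransGen_iff_eq_or_transGen.1 h2 with h4 | h4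
      · rw [← hφ h4]; exact root_reaches hT.1 hr t
      · exact absurd (Relation.TransGen.trans_left h4 h3) (hN.1 _)

theorem retic_card_le (N : Net α) :
    (Finset.univ.filter fun v => RetV N.Adj v).card ≤ N.reticNum := by
  unfold Net.reticNum
  rw [Finset.card_filter]
  refine Finset.sum_le_sum fun v _ => ?_
  split_ifs with h
  · obtain ⟨a, b, ha, hb, hne⟩ := h
    by_contra hlt
    exact hne (indeg_le_one.1 (by omega) a b ha hb)
  · exact Nat.zero_le _

theorem lower_bound {X : Finset α} {N : Net α} (hN : IsPhyloNet X N) {𝒞 : Set (Finset α)}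
    (h : RepresentsSet X N 𝒞) : mstLB X 𝒞 ≤ N.reticNum := by
  obtain ⟨x0, hx0⟩ := phylo_nonempty hN
  obtain ⟨t0, ht0, -⟩ := hN.2.2.2.2.surjOn hx0
  have : ∀ x, ∃ t, x ∈ X → N.IsLeaf t ∧ N.label t = x := by
    intro x
    by_cases hx : x ∈ X
    · obtain ⟨t, ht, rfl⟩ := hN.2.2.2.2.surjOn hx
      exact ⟨t, fun _ => ⟨ht, rfl⟩⟩
    · exact ⟨t0, fun h => absurd h hx⟩
  choose l hl using this
  obtain ⟨L, hL, hlen⟩ := LB_main N.Adj hN.1 l _ (Finset.univ.filter fun v => RetV N.Adj v) X 𝒞 rfl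
    (fun v hv _ _ _ => by simpa using hv) (fun C hC => displays_RepQ hN (h C hC) l hl)
  obtain ⟨L', hL', hlen'⟩ := maxify _ L X 𝒞 hlen hL
  have h0 : mstLB X 𝒞 ≤ (Finset.univ.filter fun v => RetV N.Adj v).card :=
    Nat.sInf_le ⟨L', hL', hlen'⟩
  exact h0.trans (retic_card_le N)
end

section
set_option linter.unusedSectionVars false
/-! ### Part C: pairs of rooted trees on a common vertex set -/

structure Sys (α : Type) where
  V : Type
  fin : Fintype V
  ρ : V
  par : Bool → V → V
  lf : α → V
  rk : V → ℚ

namespace Sys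

instance (M : Sys α) : Fintype M.V := M.fin

def Ch (M : Sys α) (i : Bool) (a b : M.V) : Prop := b ≠ M.ρ ∧ M.par i b = a

def Anc (M : Sys α) (i : Bool) : M.V → M.V → Prop := Relation.ReflTransGen (M.Ch i)

structure Good (M : Sys α) (X : Finset α) (F : Set M.V) : Prop where
  rk_lt : ∀ i v, v ≠ M.ρ → M.rk (M.par i v) < M.rk v
  inj : ∀ x ∈ X, ∀ y ∈ X, M.lf x = M.lf y → x = y
  leaf : ∀ v, (∀ i c, ¬ M.Ch i v c) ↔ ∃ x ∈ X, M.lf x = v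
  leafpar : ∀ x ∈ X, M.par true (M.lf x) = M.par false (M.lf x)
  deg : ∀ v, v ≠ M.ρ → v ∉ F → M.par true v = M.par false v → (∃ i c, M.Ch i v c) →
    ∃ i c j d, c ≠ d ∧ M.Ch i v c ∧ M.Ch j v d

/-- the set of reticulations -/
noncomputable def ret (M : Sys α) : Finset M.V :=
  Finset.univ.filter fun v => v ≠ M.ρ ∧ M.par true v ≠ M.par false v

theorem Ch.uniq {M : Sys α} {i : Bool} (a b c : M.V) (h1 : M.Ch i a c) (h2 : M.Ch i b c) : a = b :=
  h1.2.symm.trans h2.2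

theorem Anc.comparable {M : Sys α} {i : Bool} {u v w : M.V} (h1 : M.Anc i u w) (h2 : M.Anc i v w) :
    M.Anc i u v ∨ M.Anc i v u := rtg_comparable Ch.uniq h1 h2

theorem Good.anc_rk {M : Sys α} {X : Finset α} {F : Set M.V} (h : M.Good X F) {i : Bool} {u v : M.V}
    (huv : M.Anc i u v) : u = v ∨ M.rk u < M.rk v := by
  induction huv with
  | refl => exact Or.inl rfl
  | @tail b c _ hbc ih =>
    right
    have := h.rk_lt i c hbc.1
    rw [hbc.2] at this
    rcases ih with rfl | h'
    · exact this
    · exact h'.trans this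

theorem Good.antisymm {M : Sys α} {X : Finset α} {F : Set M.V} (h : M.Good X F) {i : Bool} {u v : M.V}
    (h1 : M.Anc i u v) (h2 : M.Anc i v u) : u = v := by
  rcases h.anc_rk h1 with h3 | h3
  · exact h3
  rcases h.anc_rk h2 with h4 | h4
  · exact h4.symm
  · exact absurd (h3.trans h4) (lt_irrefl _)

theorem Good.anc_root {M : Sys α} {X : Finset α} {F : Set M.V} (h : M.Good X F) (i : Bool) (v : M.V) :
    M.Anc i M.ρ v := by
  by_contra hv
  have hne : (Finset.univ.filter fun v => ¬ M.Anc i M.ρ v).Nonempty := ⟨v, by simpa using hv⟩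
  obtain ⟨w, hw, hmin⟩ := Finset.exists_min_image _ M.rk hne
  simp only [Finset.mem_filter, Finset.mem_univ, true_and] at hw hmin
  by_cases hwρ : w = M.ρ
  · subst hwρ; exact hw .refl
  · have h1 := h.rk_lt i w hwρ
    by_cases h2 : M.Anc i M.ρ (M.par i w)
    · exact hw (h2.tail ⟨hwρ, rfl⟩)
    · exact absurd (hmin _ h2) (not_le.2 h1)

theorem Good.leaf_anc {M : Sys α} {X : Finset α} {F : Set M.V} (h : M.Good X F) {i : Bool} {x : α}
    (hx : x ∈ X) {v : M.V} (hv : M.Anc i (M.lf x) v) : v = M.lf x := by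
  rcases Relation.ReflTransGen.cases_head hv with h1 | ⟨c, h1, _⟩
  · exact h1.symm
  · exact absurd h1 ((h.leaf _).2 ⟨x, hx, rfl⟩ i c)

/-! kept vertices -/

noncomputable def cl (M : Sys α) (X : Finset α) (i : Bool) (v : M.V) : Finset α :=
  X.filter fun x => M.Anc i v (M.lf x)

theorem mem_cl {M : Sys α} {X : Finset α} {i : Bool} {v : M.V} {x : α} :
    x ∈ M.cl X i v ↔ x ∈ X ∧ M.Anc i v (M.lf x) := by simp [cl]

theorem cl_anti {M : Sys α} {X : Finset α} {i : Bool} {u v : M.V} (h : M.Anc i u v) :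
    M.cl X i v ⊆ M.cl X i u := by
  intro x hx
  rw [mem_cl] at hx ⊢
  exact ⟨hx.1, h.trans hx.2⟩

def Low (M : Sys α) (X : Finset α) (i : Bool) (v : M.V) : Prop :=
  (M.cl X i v).Nonempty ∧ ∀ u, M.Anc i v u → M.cl X i u = M.cl X i v → u = v

def Kept (M : Sys α) (X : Finset α) (i : Bool) (v : M.V) : Prop := v = M.ρ ∨ M.Low X i v

def Cov (M : Sys α) (X : Finset α) (i : Bool) (u v : M.V) : Prop :=
  M.Kept X i u ∧ M.Kept X i v ∧ M.Anc i u v ∧ u ≠ v ∧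
    ∀ z, M.Kept X i z → M.Anc i u z → M.Anc i z v → z = u ∨ z = v

variable {M : Sys α} {X : Finset α} {F : Set M.V} (h : M.Good X F) {i : Bool}
include h

theorem Good.exists_cov_up {z v : M.V} (hz : M.Kept X i z) (hv : M.Kept X i v) (hzv : M.Anc i z v)
    (hne : z ≠ v) : ∃ u, M.Cov X i u v ∧ M.Anc i z u := by
  have hne' : (Finset.univ.filter fun u => M.Kept X i u ∧ M.Anc i u v ∧ u ≠ v).Nonempty :=
    ⟨z, by simp [hz, hzv, hne]⟩
  obtain ⟨u, hu, hmax⟩ := Finset.exists_max_image _ M.rk hne'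
  simp only [Finset.mem_filter, Finset.mem_univ, true_and] at hu hmax
  have key : ∀ z, M.Kept X i z → M.Anc i u z → M.Anc i z v → z = u ∨ z = v := by
    intro y hy huy hyv
    by_cases hyv' : y = v
    · exact Or.inr hyv'
    · left
      rcases h.anc_rk huy with h1 | h1
      · exact h1.symm
      · exact absurd (hmax y ⟨hy, hyv, hyv'⟩) (not_le.2 h1)
  refine ⟨u, ⟨hu.1, hv, hu.2.1, hu.2.2, key⟩, ?_⟩
  rcases hzv.comparable hu.2.1 with h1 | h1
  · exact h1
  · rcases key z hz h1 hzv with h2 | h2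
    · rw [h2]; exact .refl
    · exact absurd h2 hne

theorem Good.exists_cov_down {z v : M.V} (hz : M.Kept X i z) (hv : M.Kept X i v) (hzv : M.Anc i z v)
    (hne : z ≠ v) : ∃ d, M.Cov X i z d ∧ M.Anc i d v := by
  have hne' : (Finset.univ.filter fun u => M.Kept X i u ∧ M.Anc i z u ∧ M.Anc i u v ∧ u ≠ z).Nonempty :=
    ⟨v, by simp only [Finset.mem_filter, Finset.mem_univ, true_and]; exact ⟨hv, hzv, .refl, hne.symm⟩⟩
  obtain ⟨u, hu, hmin⟩ := Finset.exists_min_image _ M.rk hne'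
  simp only [Finset.mem_filter, Finset.mem_univ, true_and] at hu hmin
  refine ⟨u, ⟨hz, hu.1, hu.2.1, hu.2.2.2.symm, ?_⟩, hu.2.2.1⟩
  intro y hy hzy hyu
  by_cases hyz : y = z
  · exact Or.inl hyz
  · right
    rcases h.anc_rk hyu with h1 | h1
    · exact h1
    · exact absurd (hmin y ⟨hy, hzy, hyu.trans hu.2.2.1, hyz⟩) (not_le.2 h1)

theorem Good.cov_uniq {u u' v : M.V} (h1 : M.Cov X i u v) (h2 : M.Cov X i u' v) : u = u' := by
  rcases h1.2.2.1.comparable h2.2.2.1 with h3 | h3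
  · rcases h1.2.2.2.2 u' h2.1 h3 h2.2.2.1 with h4 | h4
    · exact h4.symm
    · exact absurd h4 h2.2.2.2.1
  · rcases h2.2.2.2.2 u h1.1 h3 h1.2.2.1 with h4 | h4
    · exact h4
    · exact absurd h4 h1.2.2.2.1

theorem Good.low_leaf {x : α} (hx : x ∈ X) : M.Low X i (M.lf x) :=
  ⟨⟨x, mem_cl.2 ⟨hx, .refl⟩⟩, fun _ hu _ => h.leaf_anc hx hu⟩

theorem Good.exists_low {w : M.V} (hw : (M.cl X i w).Nonempty) :
    ∃ z, M.Anc i w z ∧ M.cl X i z = M.cl X i w ∧ M.Low X i z := by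
  have hne : (Finset.univ.filter fun z => M.Anc i w z ∧ M.cl X i z = M.cl X i w).Nonempty :=
    ⟨w, by simp only [Finset.mem_filter, Finset.mem_univ, true_and, and_true]; exact .refl⟩
  obtain ⟨z, hz, hmax⟩ := Finset.exists_max_image _ M.rk hne
  simp only [Finset.mem_filter, Finset.mem_univ, true_and] at hz hmax
  refine ⟨z, hz.1, hz.2, hz.2 ▸ hw, fun u hu hcl => ?_⟩
  rcases h.anc_rk hu with h1 | h1
  · exact h1.symm
  · exact absurd (hmax u ⟨hz.1.trans hu, hcl.trans hz.2⟩) (not_le.2 h1)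

theorem Good.low_eq {u v : M.V} (hu : M.Low X i u) (hv : M.Low X i v)
    (hcl : M.cl X i u = M.cl X i v) : u = v := by
  obtain ⟨x, hx⟩ := hu.1
  have hx' := hx
  rw [hcl] at hx'
  rw [mem_cl] at hx hx'
  rcases hx.2.comparable hx'.2 with h1 | h1
  · exact (hu.2 v h1 hcl.symm).symm
  · exact hv.2 u h1 hcl

theorem Good.low_of_cov {u v : M.V} (huv : M.Cov X i u v) : M.Low X i v ∧ v ≠ M.ρ := by
  have : v ≠ M.ρ := by
    rintro rfl
    exact huv.2.2.2.1 (h.antisymm huv.2.2.1 (h.anc_root i u))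
  exact ⟨huv.2.1.resolve_left this, this⟩

theorem Good.cl_between {u v w : M.V} (huv : M.Cov X i u v) (huw : M.Anc i u w) (hwv : M.Anc i w v)
    (hw : ¬ M.Kept X i w) : M.cl X i w = M.cl X i v := by
  have hv := (h.low_of_cov huv).1
  have hne : (M.cl X i w).Nonempty := hv.1.mono (cl_anti hwv)
  obtain ⟨z, hwz, hzcl, hz⟩ := h.exists_low hne
  obtain ⟨x, hx⟩ := hv.1
  have hxz : x ∈ M.cl X i z := by rw [hzcl]; exact cl_anti hwv hx
  rw [mem_cl] at hx hxz
  rcases hxz.2.comparable hx.2 with h1 | h1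
  · rcases huv.2.2.2.2 z (Or.inr hz) (huw.trans hwz) h1 with h2 | h2
    · rw [h2] at hwz
      have := h.antisymm hwz huw
      rw [this] at hw
      exact absurd huv.1 hw
    · rw [← h2, hzcl]
  · refine le_antisymm ?_ (cl_anti hwv)
    rw [← hzcl]; exact cl_anti h1

end Sys
end

section
set_option linter.unusedSectionVars false
theorem exists_path {V : Type} {R : V → V → Prop} {u v : V} (h : Relation.ReflTransGen R u v) :
    ∃ p : List V, p.head? = some u ∧ p.getLast? = some v ∧ p.IsChain R ∧
      ∀ m ∈ p, Relation.ReflTransGen R u m ∧ Relation.ReflTransGen R m v := by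
  induction h using Relation.ReflTransGen.head_induction_on with
  | refl => exact ⟨[v], rfl, rfl, by simp, by simp [Relation.ReflTransGen.refl]⟩
  | @head a c hac hcv ih =>
    obtain ⟨p, h1, h2, h3, h4⟩ := ih
    cases p with
    | nil => simp at h1
    | cons d p =>
      simp only [List.head?_cons, Option.some.injEq] at h1
      subst h1
      refine ⟨a :: d :: p, rfl, ?_, ?_, ?_⟩
      · rw [List.getLast?_cons_cons]; exact h2
      · exact List.isChain_cons_cons.2 ⟨hac, h3⟩
      · intro m hm
        rcases List.mem_cons.1 hm with rfl | hm
        · exact ⟨.refl, hcv.head hac⟩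
        · exact ⟨(h4 m hm).1.head hac, (h4 m hm).2⟩

/-- The net of a relation on a finite type. -/
noncomputable def mkNet {V : Type} [Fintype V] (R : V → V → Prop) (lab : V → α) : Net α where
  n := Fintype.card V
  E := Finset.univ.filter fun e =>
    R ((Fintype.equivFin V).symm e.1) ((Fintype.equivFin V).symm e.2)
  label := fun a => lab ((Fintype.equivFin V).symm a)

section mk
variable {V : Type} [Fintype V] {R : V → V → Prop} {lab : V → α}

noncomputable def toF (R : V → V → Prop) (lab : V → α) : V ≃ Fin (mkNet R lab).n :=
  Fintype.equivFin V

theorem mk_adj' {a b : Fin (mkNet R lab).n} :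
    (mkNet R lab).Adj a b ↔ R ((toF R lab).symm a) ((toF R lab).symm b) :=
  Finset.mem_filter.trans ⟨fun h => h.2, fun h => ⟨Finset.mem_univ _, h⟩⟩

theorem mk_adj {a b : V} : (mkNet R lab).Adj (toF R lab a) (toF R lab b) ↔ R a b := by
  rw [mk_adj', Equiv.symm_apply_apply, Equiv.symm_apply_apply]

theorem mk_label (a : V) : (mkNet R lab).label (toF R lab a) = lab a :=
  congrArg lab (Equiv.symm_apply_apply (Fintype.equivFin V) a)

theorem mk_acyclic {rk : V → ℚ} (h : ∀ a b, R a b → rk a < rk b) (v : Fin (mkNet R lab).n) :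
    ¬ Relation.TransGen (mkNet R lab).Adj v v := by
  intro hv
  have key : ∀ a b, Relation.TransGen (mkNet R lab).Adj a b →
      rk ((toF R lab).symm a) < rk ((toF R lab).symm b) := by
    intro a b hab
    induction hab with
    | single h1 => exact h _ _ (mk_adj'.1 h1)
    | tail _ h1 ih => exact ih.trans (h _ _ (mk_adj'.1 h1))
  exact lt_irrefl _ (key v v hv)

theorem mk_leaf (a : V) : (mkNet R lab).IsLeaf (toF R lab a) ↔ ∀ b, ¬ R a b := by
  unfold Net.IsLeaf
  rw [outdeg_eq_zero]
  constructor
  · intro h b hb; exact h _ (mk_adj.2 hb)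
  · intro h b hb
    rw [mk_adj'] at hb
    simp at hb
    exact h _ hb

theorem mk_phylo {X : Finset α} {rk : V → ℚ} (hrk : ∀ a b, R a b → rk a < rk b)
    {ρ : V} (hρ : ∀ a, ¬ R a ρ) (hpar : ∀ v, v ≠ ρ → ∃ u, R u v)
    (h11 : ∀ v, v ≠ ρ → (∀ a b, R a v → R b v → a = b) → (∃ c, R v c) →
      ∃ c d, c ≠ d ∧ R v c ∧ R v d)
    (hret : ∀ v a b, R a v → R b v → a ≠ b → ∃ c, R v c)
    (lf : α → V) (hlf : ∀ x ∈ X, lab (lf x) = x)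
    (hleaf : ∀ v, (∀ c, ¬ R v c) ↔ ∃ x ∈ X, lf x = v) : IsPhyloNet X (mkNet R lab) := by
  refine ⟨mk_acyclic hrk, ⟨toF R lab ρ, ?_, ?_⟩, ?_, ?_, ?_, ?_, ?_⟩
  · simp only
    rw [indeg_eq_zero]
    intro u hu
    rw [mk_adj'] at hu
    simp at hu
    exact hρ _ hu
  · intro v hv
    obtain ⟨v, rfl⟩ := (toF R lab).surjective v
    rw [indeg_eq_zero] at hv
    by_contra hne
    obtain ⟨u, hu⟩ := hpar v (fun h => hne (by rw [h]))
    exact hv _ (mk_adj.2 hu)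
  · rintro v ⟨h1, h2⟩
    obtain ⟨v, rfl⟩ := (toF R lab).surjective v
    have hvρ : v ≠ ρ := by
      rintro rfl
      have : (mkNet R lab).indeg (toF R lab v) = 0 := by
        rw [indeg_eq_zero]
        intro u hu
        rw [mk_adj'] at hu
        simp at hu
        exact hρ _ hu
      omega
    have hc : ∃ c, R v c := by
      by_contra hc
      push Not at hc
      have : (mkNet R lab).outdeg (toF R lab v) = 0 := (mk_leaf v).2 hc
      omega
    obtain ⟨c, d, hcd, hc, hd⟩ := h11 v hvρ (fun a b ha hb => (toF R lab).injective
      (indeg_le_one.1 h1.le _ _ (mk_adj.2 ha) (mk_adj.2 hb))) hc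
    exact hcd ((toF R lab).injective (outdeg_le_one.1 h2.le _ _ (mk_adj.2 hc) (mk_adj.2 hd)))
  · intro v hv
    obtain ⟨v, rfl⟩ := (toF R lab).surjective v
    have : ¬ (mkNet R lab).indeg (toF R lab v) ≤ 1 := by omega
    rw [indeg_le_one] at this
    push Not at this
    obtain ⟨a, b, ha, hb, hab⟩ := this
    rw [mk_adj', Equiv.symm_apply_apply] at ha hb
    obtain ⟨c, hc⟩ := hret v _ _ ha hb (fun h => hab ((toF R lab).symm.injective h))
    by_contra hlt
    have : (mkNet R lab).outdeg (toF R lab v) = 0 := by omega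
    exact (mk_leaf v).1 this c hc
  · intro v hv
    obtain ⟨v, rfl⟩ := (toF R lab).surjective v
    obtain ⟨x, hx, rfl⟩ := (hleaf v).1 ((mk_leaf v).1 hv)
    rw [mk_label, hlf x hx]
    exact hx
  · intro v hv w hw hvw
    obtain ⟨v, rfl⟩ := (toF R lab).surjective v
    obtain ⟨w, rfl⟩ := (toF R lab).surjective w
    obtain ⟨x, hx, rfl⟩ := (hleaf v).1 ((mk_leaf v).1 hv)
    obtain ⟨y, hy, rfl⟩ := (hleaf w).1 ((mk_leaf w).1 hw)
    rw [mk_label, mk_label, hlf x hx, hlf y hy] at hvw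
    rw [hvw]
  · intro x hx
    exact ⟨toF R lab (lf x), (mk_leaf _).2 ((hleaf _).2 ⟨x, hx, rfl⟩), by rw [mk_label, hlf x hx]⟩

theorem mk_reticNum_le (S : Finset V) (h : ∀ v a b, v ∉ S → R a v → R b v → a = b)
    (h2 : ∀ v, ∃ a b, ∀ c, R c v → c = a ∨ c = b) : (mkNet R lab).reticNum ≤ S.card := by
  unfold Net.reticNum
  rw [← Equiv.sum_comp (toF R lab), Finset.card_eq_sum_ones, ← Finset.sum_filter_add_sum_filter_not
    Finset.univ (fun v => v ∈ S)]
  have hz : ∑ v ∈ Finset.univ.filter (fun v => v ∉ S),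
      ((mkNet R lab).indeg (toF R lab v) - 1) = 0 := by
    refine Finset.sum_eq_zero fun v hv => ?_
    simp only [Finset.mem_filter, Finset.mem_univ, true_and] at hv
    have : (mkNet R lab).indeg (toF R lab v) ≤ 1 := by
      rw [indeg_le_one]
      intro a b ha hb
      rw [mk_adj', Equiv.symm_apply_apply] at ha hb
      exact (toF R lab).symm.injective (h v _ _ hv ha hb)
    omega
  rw [hz, add_zero, Finset.filter_mem_eq_inter, Finset.univ_inter]
  refine Finset.sum_le_sum fun v _ => ?_
  obtain ⟨a, b, hab⟩ := h2 v
  have : (mkNet R lab).indeg (toF R lab v) ≤ 2 := by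
    unfold Net.indeg
    refine le_trans (Finset.card_le_card (t := {(toF R lab a, toF R lab v), (toF R lab b, toF R lab v)})
      ?_) Finset.card_le_two
    rintro ⟨c, d⟩ hcd
    simp only [Finset.mem_filter] at hcd
    obtain ⟨hcd, rfl⟩ := hcd
    have hcd' : (mkNet R lab).Adj c (toF R lab v) := hcd
    rw [mk_adj', Equiv.symm_apply_apply] at hcd'
    rcases hab _ hcd' with h | h
    · simp [← h]
    · simp [← h]
  omega

end mk

namespace Sys
variable (M : Sys α) (X : Finset α)

def NR (a b : M.V) : Prop := ∃ i, M.Ch i a b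

/-- Labelling of the vertices, inverse to `lf`. -/
noncomputable def lab (x0 : α) (v : M.V) : α :=
  if h : ∃ x ∈ X, M.lf x = v then h.choose else x0

variable {M X} {F : Set M.V}

theorem Good.lab_lf (h : M.Good X F) (x0 : α) {x : α} (hx : x ∈ X) : M.lab X x0 (M.lf x) = x := by
  have h' : ∃ y ∈ X, M.lf y = M.lf x := ⟨x, hx, rfl⟩
  unfold lab
  rw [dif_pos h']
  exact h.inj _ h'.choose_spec.1 _ hx h'.choose_spec.2

noncomputable def net (M : Sys α) (X : Finset α) (x0 : α) : Net α := mkNet M.NR (M.lab X x0)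

theorem Good.net_phylo (h : M.Good X ∅) (x0 : α) : IsPhyloNet X (M.net X x0) := by
  refine mk_phylo (rk := M.rk) (ρ := M.ρ) (lf := M.lf) ?_ ?_ ?_ ?_ ?_ ?_ ?_
  · rintro a b ⟨i, hb, rfl⟩
    exact h.rk_lt i b hb
  · rintro a ⟨i, hb, _⟩; exact hb rfl
  · intro v hv; exact ⟨_, true, hv, rfl⟩
  · rintro v hv hu ⟨c, i, hc⟩
    obtain ⟨i, c, j, d, hcd, hc, hd⟩ := h.deg v hv (by simp)
      (hu _ _ ⟨true, hv, rfl⟩ ⟨false, hv, rfl⟩) ⟨i, c, hc⟩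
    exact ⟨c, d, hcd, ⟨i, hc⟩, ⟨j, hd⟩⟩
  · rintro v a b ⟨i, hv, rfl⟩ ⟨j, _, rfl⟩ hne
    by_contra hc
    push Not at hc
    obtain ⟨x, hx, rfl⟩ := (h.leaf v).1 (fun i c hic => hc c ⟨i, hic⟩)
    have := h.leafpar x hx
    cases i <;> cases j <;> simp_all
  · intro x hx; exact h.lab_lf x0 hx
  · intro v
    rw [← h.leaf v]
    constructor
    · intro h1 i c hc; exact h1 c ⟨i, hc⟩
    · rintro h1 c ⟨i, hc⟩; exact h1 i c hc

theorem net_retic (M : Sys α) (X : Finset α) (x0 : α) : (M.net X x0).reticNum ≤ M.ret.card := by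
  refine mk_reticNum_le _ ?_ ?_
  · rintro v a b hv ⟨i, hvρ, rfl⟩ ⟨j, _, rfl⟩
    simp only [ret, Finset.mem_filter, Finset.mem_univ, true_and, not_and, not_not] at hv
    have := hv hvρ
    cases i <;> cases j <;> simp_all
  · intro v
    refine ⟨M.par true v, M.par false v, ?_⟩
    rintro c ⟨i, _, rfl⟩
    cases i <;> simp

/-- The tree displayed. -/
noncomputable def tree (M : Sys α) (X : Finset α) (x0 : α) (i : Bool) : Net α :=
  mkNet (V := {v : M.V // M.Kept X i v}) (fun a b => M.Cov X i a.1 b.1)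
    (fun a => M.lab X x0 a.1)

theorem Good.tree_leaf (h : M.Good X F) (hX : X.Nonempty) (i : Bool)
    (v : {v : M.V // M.Kept X i v}) :
    (∀ c : {v : M.V // M.Kept X i v}, ¬ M.Cov X i v.1 c.1) ↔ ∃ x ∈ X, M.lf x = v.1 := by
  constructor
  · intro hc
    have hne : (M.cl X i v.1).Nonempty := by
      rcases v.2 with h1 | h1
      · obtain ⟨x, hx⟩ := hX
        exact ⟨x, mem_cl.2 ⟨hx, by rw [h1]; exact h.anc_root _ _⟩⟩
      · exact h1.1
    obtain ⟨x, hx⟩ := hne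
    rw [mem_cl] at hx
    refine ⟨x, hx.1, ?_⟩
    by_contra hne
    obtain ⟨d, hd, _⟩ := h.exists_cov_down v.2 (Or.inr (h.low_leaf hx.1)) hx.2 (Ne.symm hne)
    exact hc ⟨d, hd.2.1⟩ hd
  · rintro ⟨x, hx, hxv⟩ c hc
    rw [← hxv] at hc
    exact hc.2.2.2.1 (h.leaf_anc hx hc.2.2.1).symm

theorem Good.tree_phylo (h : M.Good X F) (hX : X.Nonempty) (x0 : α) (i : Bool) :
    IsPhyloTree X (M.tree X x0 i) := by
  obtain ⟨x1, hx1⟩ := hX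
  constructor
  · refine mk_phylo (rk := fun a => M.rk a.1) (ρ := ⟨M.ρ, Or.inl rfl⟩)
      (lf := fun x => if hx : x ∈ X then ⟨M.lf x, Or.inr (h.low_leaf hx)⟩ else ⟨M.ρ, Or.inl rfl⟩)
      ?_ ?_ ?_ ?_ ?_ ?_ ?_
    · intro a b hab
      rcases h.anc_rk hab.2.2.1 with h1 | h1
      · exact absurd h1 hab.2.2.2.1
      · exact h1
    · intro a ha
      exact (h.low_of_cov ha).2 rfl
    · rintro ⟨v, hv⟩ hne
      obtain ⟨u, hu, _⟩ := h.exists_cov_up (Or.inl rfl) hv (h.anc_root i v)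
        (fun h' => hne (Subtype.ext h'.symm))
      exact ⟨⟨u, hu.1⟩, hu⟩
    · rintro ⟨v, hv⟩ hne _ ⟨⟨c, hc⟩, hvc⟩
      simp only at hvc
      have hlow : M.Low X i v := hv.resolve_left (fun h' => hne (Subtype.ext h'))
      have hncl : M.cl X i c ≠ M.cl X i v := fun h' => hvc.2.2.2.1 (hlow.2 c hvc.2.2.1 h').symm
      have hss : ¬ M.cl X i v ⊆ M.cl X i c := fun h' =>
        hncl (le_antisymm (cl_anti hvc.2.2.1) h')
      obtain ⟨x, hx, hxc⟩ := Finset.not_subset.1 hss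
      rw [mem_cl] at hx
      have hvx : v ≠ M.lf x := by
        rintro rfl
        exact hvc.2.2.2.1 (h.leaf_anc hx.1 hvc.2.2.1).symm
      obtain ⟨d, hd, hdx⟩ := h.exists_cov_down hv (Or.inr (h.low_leaf hx.1)) hx.2 hvx
      refine ⟨⟨c, hc⟩, ⟨d, hd.2.1⟩, ?_, hvc, hd⟩
      intro h'
      have h' := congrArg Subtype.val h'
      simp only at h'
      subst h'
      exact hxc (mem_cl.2 ⟨hx.1, hdx⟩)
    · intro v a b ha hb hab
      exact absurd (Subtype.ext (h.cov_uniq ha hb)) hab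
    · intro x hx
      simp only [dif_pos hx]
      exact h.lab_lf x0 hx
    · intro v
      rw [h.tree_leaf ⟨x1, hx1⟩ i v]
      constructor
      · rintro ⟨x, hx, hxv⟩
        exact ⟨x, hx, by rw [dif_pos hx]; exact Subtype.ext hxv⟩
      · rintro ⟨x, hx, hxv⟩
        rw [dif_pos hx] at hxv
        exact ⟨x, hx, congrArg Subtype.val hxv⟩
  · have := mk_reticNum_le (V := {v : M.V // M.Kept X i v}) (R := fun a b => M.Cov X i a.1 b.1)
      (lab := fun a => M.lab X x0 a.1) ∅ (fun v a b _ ha hb => Subtype.ext (h.cov_uniq ha hb)) ?_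
    · simpa [tree] using this
    · intro v
      by_cases hv : ∃ a : {v : M.V // M.Kept X i v}, M.Cov X i a.1 v.1
      · obtain ⟨a, ha⟩ := hv
        exact ⟨a, a, fun c hc => Or.inl (Subtype.ext (h.cov_uniq hc ha))⟩
      · push Not at hv
        exact ⟨v, v, fun c hc => absurd hc (hv c)⟩

end Sys
end

section
set_option linter.unusedSectionVars false
namespace Sys
variable {M : Sys α} {X : Finset α} {F : Set M.V}

noncomputable def eN (M : Sys α) (X : Finset α) (x0 : α) : M.V ≃ Fin (M.net X x0).n :=
  toF M.NR (M.lab X x0)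

theorem net_adj {x0 : α} {a b : M.V} :
    (M.net X x0).Adj (M.eN X x0 a) (M.eN X x0 b) ↔ M.NR a b := mk_adj

theorem Good.path (h : M.Good X ∅) (x0 : α) {i : Bool} {u v : M.V} (huv : M.Anc i u v) (hne : u ≠ v) :
    ∃ p : List (Fin (M.net X x0).n), IsDirPath (M.net X x0) (M.eN X x0 u)
      (M.eN X x0 v) p ∧
      ∀ w ∈ internals p, ∃ w', w = M.eN X x0 w' ∧ M.Anc i u w' ∧ M.Anc i w' v ∧
        w' ≠ u ∧ w' ≠ v := by
  obtain ⟨p, h1, h2, h3, h4⟩ := exists_path huv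
  have hch : (p.map (M.eN X x0)).IsChain (M.net X x0).Adj := by
    rw [List.isChain_map]
    exact h3.imp fun a b hab => net_adj.2 ⟨i, hab⟩
  have hnd := nodup_of_chain (h.net_phylo x0).1 hch
  refine ⟨p.map (M.eN X x0), ⟨by simp [h1], by simp [h2], hch, ?_⟩, ?_⟩
  · rw [List.length_map]
    match p, h1, h2 with
    | [a], h1, h2 =>
      simp at h1 h2
      exact absurd (h1.symm.trans h2) hne
    | a :: b :: p, _, _ => simp
  · intro w hw
    obtain ⟨k, hk0, hk1, hk⟩ := mem_internals.1 hw
    have hk' := hk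
    rw [List.getElem?_map, Option.map_eq_some_iff] at hk'
    obtain ⟨w', hw', rfl⟩ := hk'
    have hm := h4 w' (List.mem_of_getElem? hw')
    refine ⟨w', rfl, hm.1, hm.2, ?_, ?_⟩
    · rintro rfl
      have : (p.map (M.eN X x0))[0]? = some (M.eN X x0 w') := by
        rw [← List.head?_eq_getElem?]; simp [h1]
      have := nodup_idx hnd hk this
      omega
    · rintro rfl
      have : (p.map (M.eN X x0))[(p.map (M.eN X x0)).length - 1]? =
          some (M.eN X x0 w') := by
        rw [← List.getLast?_eq_getElem?]; simp [h2]
      have := nodup_idx hnd hk this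
      omega

/-- The equivalence between kept vertices and vertices of the displayed tree. -/
noncomputable def eT (M : Sys α) (X : Finset α) (x0 : α) (i : Bool) :
    {v : M.V // M.Kept X i v} ≃ Fin (M.tree X x0 i).n :=
  toF (fun a b => M.Cov X i a.1 b.1) (fun a => M.lab X x0 a.1)

theorem tree_adj {x0 : α} {i : Bool} {a b : Fin (M.tree X x0 i).n} :
    (M.tree X x0 i).Adj a b ↔ M.Cov X i ((M.eT X x0 i).symm a).1 ((M.eT X x0 i).symm b).1 :=
  mk_adj'

theorem Good.displays (h : M.Good X ∅) (hX : X.Nonempty) (x0 : α) (i : Bool) :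
    Displays (M.net X x0) (M.tree X x0 i) := by
  have hex : ∀ e : Fin (M.tree X x0 i).n × Fin (M.tree X x0 i).n,
      ∃ p : List (Fin (M.net X x0).n), e ∈ (M.tree X x0 i).E →
        IsDirPath (M.net X x0) (M.eN X x0 ((M.eT X x0 i).symm e.1).1)
          (M.eN X x0 ((M.eT X x0 i).symm e.2).1) p ∧
        ∀ w ∈ internals p, ∃ w', w = M.eN X x0 w' ∧ M.Anc i ((M.eT X x0 i).symm e.1).1 w' ∧
          M.Anc i w' ((M.eT X x0 i).symm e.2).1 ∧
          ¬ M.Kept X i w' := by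
    intro e
    by_cases he : e ∈ (M.tree X x0 i).E
    · have hc := tree_adj.1 he
      obtain ⟨p, hp, hp2⟩ := h.path x0 hc.2.2.1 hc.2.2.2.1
      refine ⟨p, fun _ => ⟨hp, fun w hw => ?_⟩⟩
      obtain ⟨w', h1, h2, h3, h4, h5⟩ := hp2 w hw
      refine ⟨w', h1, h2, h3, fun hk => ?_⟩
      rcases hc.2.2.2.2 w' hk h2 h3 with h6 | h6
      · exact h4 h6
      · exact h5 h6
    · exact ⟨[], fun h' => absurd h' he⟩
  choose P hP using hex
  refine ⟨fun a => M.eN X x0 ((M.eT X x0 i).symm a).1, ?_, ?_, P, fun e he => (hP e he).1, ?_, ?_⟩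
  · intro a b hab
    exact (M.eT X x0 i).symm.injective (Subtype.ext ((M.eN X x0).injective hab))
  · intro v hv
    obtain ⟨v, rfl⟩ := (M.eT X x0 i).surjective v
    have h1 := (mk_leaf v).1 hv
    rw [h.tree_leaf hX] at h1
    constructor
    · refine (mk_leaf _).2 ?_
      rw [← h.leaf] at h1
      rintro b ⟨j, hj⟩
      simp only [Equiv.symm_apply_apply] at hj
      exact h1 j b hj
    · simp only [Equiv.symm_apply_apply]
      exact (mk_label (R := M.NR) (lab := M.lab X x0) v.1).trans
        (mk_label (R := fun a b : {v : M.V // M.Kept X i v} => M.Cov X i a.1 b.1)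
          (lab := fun a => M.lab X x0 a.1) v).symm
  · rintro e he w hw ⟨a, ha⟩
    obtain ⟨w', rfl, _, _, h4⟩ := (hP e he).2 w hw
    have := (M.eN X x0).injective ha
    exact h4 (this ▸ ((M.eT X x0 i).symm a).2)
  · intro e he f hf hne w hw hw'
    obtain ⟨w1, rfl, a1, a2, a3⟩ := (hP e he).2 w hw
    obtain ⟨w2, h2, b1, b2, b3⟩ := (hP f hf).2 _ hw'
    obtain rfl := (M.eN X x0).injective h2
    have ce := tree_adj.1 he
    have cf := tree_adj.1 hf
    have e1 := h.cl_between ce a1 a2 a3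
    have e2 := h.cl_between cf b1 b2 b3
    have e3 := h.low_eq (h.low_of_cov ce).1 (h.low_of_cov cf).1 (e1.symm.trans e2)
    rw [e3] at ce
    have e4 := h.cov_uniq ce cf
    exact hne (Prod.ext ((M.eT X x0 i).symm.injective (Subtype.ext e4))
      ((M.eT X x0 i).symm.injective (Subtype.ext e3)))

theorem Good.tree_reaches (h : M.Good X F) {x0 : α} {i : Bool} {a b : Fin (M.tree X x0 i).n} :
    (M.tree X x0 i).Reaches a b ↔ M.Anc i ((M.eT X x0 i).symm a).1 ((M.eT X x0 i).symm b).1 := by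
  constructor
  · intro hab
    induction hab with
    | refl => exact .refl
    | tail _ hbc ih => exact ih.trans (tree_adj.1 hbc).2.2.1
  · intro hab
    have hwf : WellFounded (fun a b : Fin (M.tree X x0 i).n =>
        M.rk ((M.eT X x0 i).symm a).1 < M.rk ((M.eT X x0 i).symm b).1) := by
      have : Std.Irrefl (fun a b : Fin (M.tree X x0 i).n =>
        M.rk ((M.eT X x0 i).symm a).1 < M.rk ((M.eT X x0 i).symm b).1) := ⟨fun _ => lt_irrefl _⟩
      have : IsTrans _ (fun a b : Fin (M.tree X x0 i).n =>
        M.rk ((M.eT X x0 i).symm a).1 < M.rk ((M.eT X x0 i).symm b).1) :=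
        ⟨fun _ _ _ => lt_trans⟩
      exact Finite.wellFounded_of_trans_of_irrefl _
    induction b using hwf.induction with
    | _ b ih =>
      by_cases hne : ((M.eT X x0 i).symm a).1 = ((M.eT X x0 i).symm b).1
      · rw [(M.eT X x0 i).symm.injective (Subtype.ext hne)]; exact .refl
      · obtain ⟨u, hu, hau⟩ := h.exists_cov_up ((M.eT X x0 i).symm a).2 ((M.eT X x0 i).symm b).2
          hab hne
        have h1 := ih (M.eT X x0 i ⟨u, hu.1⟩) (by
          rw [Equiv.symm_apply_apply]
          rcases h.anc_rk hu.2.2.1 with h2 | h2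
          · exact absurd h2 hu.2.2.2.1
          · exact h2) (by rw [Equiv.symm_apply_apply]; exact hau)
        refine h1.tail (tree_adj.2 ?_)
        rw [Equiv.symm_apply_apply]; exact hu

theorem Good.represents (h : M.Good X ∅) (x0 : α) {i : Bool} {w : M.V}
    (hw : w ≠ M.ρ) (hne : (M.cl X i w).Nonempty) :
    RepresentsCluster X (M.net X x0) (M.cl X i w) := by
  have hX : X.Nonempty := hne.mono (Finset.filter_subset _ _)
  refine ⟨M.tree X x0 i, h.tree_phylo hX x0 i, h.displays hX x0 i, ?_⟩
  obtain ⟨z, hwz, hcl, hz⟩ := h.exists_low hne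
  have hzρ : z ≠ M.ρ := by
    rintro rfl
    exact hw (h.antisymm hwz (h.anc_root i w))
  obtain ⟨u, hu, _⟩ := h.exists_cov_up (Or.inl rfl) (Or.inr hz) (h.anc_root i z) hzρ.symm
  refine ⟨(M.eT X x0 i ⟨u, hu.1⟩, M.eT X x0 i ⟨z, hu.2.1⟩), tree_adj.2 ?_, ?_⟩
  · simp only [Equiv.symm_apply_apply]; exact hu
  · ext x
    rw [mem_clusterBelow, ← hcl, mem_cl]
    constructor
    · rintro ⟨t, ⟨h1, h2⟩, h3⟩
      obtain ⟨t, rfl⟩ := (M.eT X x0 i).surjective t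
      rw [h.tree_reaches] at h1
      simp only [Equiv.symm_apply_apply] at h1
      obtain ⟨y, hy, hyt⟩ := (h.tree_leaf hX i t).1 ((mk_leaf t).1 h2)
      have h4 : (M.tree X x0 i).label (M.eT X x0 i t) = M.lab X x0 t.1 :=
        mk_label (R := fun a b : {v : M.V // M.Kept X i v} => M.Cov X i a.1 b.1)
          (lab := fun a => M.lab X x0 a.1) t
      rw [h4, ← hyt, h.lab_lf x0 hy] at h3
      subst h3
      exact ⟨hy, hyt ▸ h1⟩
    · rintro ⟨hx, h1⟩
      refine ⟨M.eT X x0 i ⟨M.lf x, Or.inr (h.low_leaf hx)⟩, ⟨?_, ?_⟩, ?_⟩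
      · rw [h.tree_reaches]
        simp only [Equiv.symm_apply_apply]; exact h1
      · exact (mk_leaf _).2 ((h.tree_leaf hX i _).2 ⟨x, hx, rfl⟩)
      · exact (mk_label (R := fun a b : {v : M.V // M.Kept X i v} => M.Cov X i a.1 b.1)
          (lab := fun a => M.lab X x0 a.1) _).trans (h.lab_lf x0 hx)

end Sys
end

section
set_option linter.unusedSectionVars false
namespace Sys

theorem Good.anc_par {M : Sys α} {X : Finset α} {F : Set M.V} (h : M.Good X F) {i : Bool} {u w : M.V}
    (hw : w ≠ M.ρ) : M.Anc i u (M.par i w) ↔ M.Anc i u w ∧ u ≠ w := by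
  constructor
  · intro h1
    refine ⟨h1.tail ⟨hw, rfl⟩, ?_⟩
    rintro rfl
    have h2 := h.rk_lt i u hw
    rcases h.anc_rk h1 with h3 | h3
    · rw [← h3] at h2; exact lt_irrefl _ h2
    · exact lt_irrefl _ (h2.trans h3)
  · rintro ⟨h1, h2⟩
    rcases Relation.ReflTransGen.cases_tail h1 with h3 | ⟨c, h3, h4⟩
    · exact absurd h3.symm h2
    · rw [h4.2]; exact h3

/-- subdivide the edge above `w` in tree `i` -/
noncomputable def sub (M : Sys α) (i : Bool) (w : M.V) : Sys α where
  V := Option M.V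
  fin := inferInstance
  ρ := some M.ρ
  par := fun j v => match v with
    | none => some (M.par i w)
    | some v => if v = w ∧ M.par j w = M.par i w then none else some (M.par j v)
  lf := fun x => some (M.lf x)
  rk := fun v => match v with
    | none => (M.rk (M.par i w) + M.rk w) / 2
    | some v => M.rk v

section sub
variable {M : Sys α} {X : Finset α} {F : Set M.V} {i j : Bool} {w : M.V}

theorem sub_ch_none {a : Option M.V} : (M.sub i w).Ch j a none ↔ a = some (M.par i w) := by
  constructor
  · rintro ⟨_, h⟩; exact h.symm
  · rintro rfl; exact ⟨by simp [sub], rfl⟩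

theorem sub_ch_some {a : Option M.V} {v : M.V} : (M.sub i w).Ch j a (some v) ↔
    v ≠ M.ρ ∧ (if v = w ∧ M.par j w = M.par i w then none else some (M.par j v)) = a := by
  constructor
  · rintro ⟨h1, h⟩; exact ⟨fun h2 => h1 (by rw [h2]; rfl), h⟩
  · rintro ⟨h1, h⟩; exact ⟨fun h2 => h1 (Option.some_injective _ h2), h⟩

theorem sub_anc_lift (hw : w ≠ M.ρ) {u v : M.V} (h : M.Anc j u v) :
    (M.sub i w).Anc j (some u) (some v) := by
  induction h with
  | refl => exact .refl
  | @tail b c _ hbc ih =>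
    by_cases hc : c = w ∧ M.par j w = M.par i w
    · have h1 : (M.sub i w).Ch j (some b) none :=
        sub_ch_none.2 (by rw [← hbc.2, hc.1, hc.2])
      have h2 : (M.sub i w).Ch j none (some c) := sub_ch_some.2 ⟨hbc.1, by rw [if_pos hc]⟩
      exact (ih.tail h1).tail h2
    · exact ih.tail (sub_ch_some.2 ⟨hbc.1, by rw [if_neg hc, hbc.2]⟩)

theorem sub_anc_desc (hw : w ≠ M.ρ) {u : M.V} {b : Option M.V} (h : (M.sub i w).Anc j (some u) b) :
    M.Anc j u (b.getD (M.par i w)) := by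
  induction h with
  | refl => exact .refl
  | @tail b c _ hbc ih =>
    match c, hbc with
    | none, hbc =>
      rw [sub_ch_none] at hbc
      subst hbc
      exact ih
    | some c, hbc =>
      rw [sub_ch_some] at hbc
      obtain ⟨h1, h2⟩ := hbc
      split_ifs at h2 with h3
      · subst h2
        refine Relation.ReflTransGen.tail ih ⟨h1, ?_⟩
        rw [h3.1]; exact h3.2
      · subst h2
        exact Relation.ReflTransGen.tail ih ⟨h1, rfl⟩

theorem sub_anc (hw : w ≠ M.ρ) {u v : M.V} : (M.sub i w).Anc j (some u) (some v) ↔ M.Anc j u v :=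
  ⟨fun h => sub_anc_desc hw h, sub_anc_lift hw⟩

theorem sub_anc_none (hw : w ≠ M.ρ) {u : M.V} :
    (M.sub i w).Anc j (some u) none ↔ M.Anc j u (M.par i w) :=
  ⟨fun h => sub_anc_desc hw h, fun h => (sub_anc_lift hw h).tail (sub_ch_none.2 rfl)⟩

theorem sub_none_anc (hw : w ≠ M.ρ) (hj : M.par j w = M.par i w) {v : M.V} :
    (M.sub i w).Anc j none (some v) ↔ M.Anc j w v := by
  have h0 : (M.sub i w).Ch j none (some w) := sub_ch_some.2 ⟨hw, by rw [if_pos ⟨rfl, hj⟩]⟩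
  constructor
  · intro h
    rcases Relation.ReflTransGen.cases_head h with h1 | ⟨c, h1, h2⟩
    · cases h1
    · match c, h1, h2 with
      | none, h1, _ => rw [sub_ch_none] at h1; cases h1
      | some c, h1, h2 =>
        rw [sub_ch_some] at h1
        obtain ⟨_, h3⟩ := h1
        split_ifs at h3 with h4
        rw [h4.1] at h2
        exact (sub_anc hw).1 h2
  · intro h
    exact Relation.ReflTransGen.head h0 (sub_anc_lift hw h)

theorem sub_ch_exists {v c : M.V} (h : M.Ch j v c) :
    ∃ c' : Option M.V, (M.sub i w).Ch j (some v) c' ∧ c'.getD w = c := by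
  by_cases hc : c = w ∧ M.par j w = M.par i w
  · exact ⟨none, sub_ch_none.2 (by rw [← h.2, hc.1, hc.2]), hc.1.symm⟩
  · exact ⟨some c, sub_ch_some.2 ⟨h.1, by rw [if_neg hc, h.2]⟩, rfl⟩

theorem Good.sub (h : M.Good X F) (hw : w ≠ M.ρ) (F' : Set (Option M.V)) (hF1 : none ∈ F')
    (hF2 : ∀ v ∈ F, some v ∈ F') :
    (M.sub i w).Good X F' where
  rk_lt := by
    intro j v hv
    match v, hv with
    | none, _ =>
      have := h.rk_lt i w hw
      show M.rk (M.par i w) < (M.rk (M.par i w) + M.rk w) / 2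
      linarith
    | some v, hv =>
      have hv' : v ≠ M.ρ := fun h => hv (by rw [h]; rfl)
      by_cases hc : v = w ∧ M.par j w = M.par i w
      · have e : (M.sub i w).par j (some v) = none := if_pos hc
        rw [e]
        have := h.rk_lt i w hw
        show (M.rk (M.par i w) + M.rk w) / 2 < M.rk v
        rw [hc.1]
        linarith
      · have e : (M.sub i w).par j (some v) = some (M.par j v) := if_neg hc
        rw [e]
        exact h.rk_lt j v hv'
  inj := fun x hx y hy hxy => h.inj x hx y hy (Option.some_injective _ hxy)
  leaf := by
    intro v
    match v with
    | none =>
      constructor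
      · intro h1
        exact absurd (sub_ch_some.2 ⟨hw, by rw [if_pos ⟨rfl, rfl⟩]⟩) (h1 i (some w))
      · rintro ⟨x, _, hx⟩; cases hx
    | some v =>
      have key : (∃ x ∈ X, (M.sub i w).lf x = some v) ↔ ∃ x ∈ X, M.lf x = v :=
        ⟨fun ⟨x, hx, e⟩ => ⟨x, hx, Option.some_injective _ e⟩, fun ⟨x, hx, e⟩ => ⟨x, hx, congrArg some e⟩⟩
      rw [key, ← h.leaf]
      constructor
      · intro h1 j c hc
        obtain ⟨c', hc', _⟩ := sub_ch_exists (i := i) (w := w) hc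
        exact h1 j c' hc'
      · intro h1 j c hc
        match c, hc with
        | none, hc =>
          rw [sub_ch_none] at hc
          exact h1 i w ⟨hw, (Option.some_injective _ hc).symm⟩
        | some c, hc =>
          rw [sub_ch_some] at hc
          obtain ⟨h2, h3⟩ := hc
          split_ifs at h3
          exact h1 j c ⟨h2, Option.some_injective _ h3⟩
  leafpar := by
    intro x hx
    have := h.leafpar x hx
    show (if M.lf x = w ∧ M.par true w = M.par i w then none else some (M.par true (M.lf x))) =
      (if M.lf x = w ∧ M.par false w = M.par i w then none else some (M.par false (M.lf x)))
    by_cases hc : M.lf x = w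
    · rw [hc] at this ⊢
      rw [this]
    · simp [hc, this]
  deg := by
    intro v hv hvF hp hex
    match v, hv, hvF, hp, hex with
    | none, _, hvF, _, _ => exact absurd hF1 hvF
    | some v, hv, hvF, hp, hex =>
      have hv' : v ≠ M.ρ := fun h => hv (by rw [h]; rfl)
      have hvF' : v ∉ F := fun h => hvF (hF2 v h)
      have hp' : M.par true v = M.par false v := by
        change (if v = w ∧ M.par true w = M.par i w then none else some (M.par true v)) =
          (if v = w ∧ M.par false w = M.par i w then none else some (M.par false v)) at hp
        split_ifs at hp with h1 h2 h2
        · rw [h1.1, h1.2, h2.2]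
        · exact Option.some_injective _ hp
      have hex' : ∃ i c, M.Ch i v c := by
        obtain ⟨j, c, hc⟩ := hex
        match c, hc with
        | none, hc =>
          rw [sub_ch_none] at hc
          exact ⟨i, w, hw, (Option.some_injective _ hc).symm⟩
        | some c, hc =>
          rw [sub_ch_some] at hc
          obtain ⟨h2, h3⟩ := hc
          split_ifs at h3
          exact ⟨j, c, h2, Option.some_injective _ h3⟩
      obtain ⟨a, c, b, d, hcd, hc, hd⟩ := h.deg v hv' hvF' hp' hex'
      obtain ⟨c', hc', e1⟩ := sub_ch_exists (i := i) (w := w) hc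
      obtain ⟨d', hd', e2⟩ := sub_ch_exists (i := i) (w := w) hd
      refine ⟨a, c', b, d', ?_, hc', hd'⟩
      rintro rfl
      exact hcd (e1.symm.trans e2)

theorem sub_ret : (M.sub i w).ret.card ≤ M.ret.card := by
  have : (M.sub i w).ret ⊆ M.ret.map ⟨some, Option.some_injective _⟩ := by
    intro v hv
    have hv2 := (Finset.mem_filter.1 hv).2
    match v, hv2 with
    | none, hv2 => exact absurd rfl hv2.2
    | some v, hv2 =>
      refine Finset.mem_map.2 ⟨v, Finset.mem_filter.2 ⟨Finset.mem_univ _, ?_, ?_⟩, rfl⟩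
      · rintro rfl; exact hv2.1 rfl
      · intro hp
        apply hv2.2
        show (if v = w ∧ M.par true w = M.par i w then none else some (M.par true v)) =
          (if v = w ∧ M.par false w = M.par i w then none else some (M.par false v))
        by_cases hc : v = w
        · rw [hc] at hp ⊢
          rw [hp]
        · simp [hc, hp]
  calc _ ≤ _ := Finset.card_le_card this
    _ = _ := Finset.card_map _

end sub

/-- result of subdividing the edge above `w i` in tree `i` for both `i` -/
structure SubOK (M : Sys α) (X : Finset α) (w : Bool → M.V) (M' : Sys α) (a : Bool → M'.V)
    (e : M.V → M'.V) : Prop where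
  good : M'.Good X {v | ∃ i, v = a i}
  aρ : ∀ i, a i ≠ M'.ρ
  ach : ∀ i, ∃ j c, M'.Ch j (a i) c
  eρ : ∀ v, v ≠ M.ρ → e v ≠ M'.ρ
  ee : ∀ i u v, M'.Anc i (e u) (e v) ↔ M.Anc i u v
  ae : ∀ i v, M'.Anc i (a i) (e v) ↔ M.Anc i (w i) v
  ea : ∀ i u, M'.Anc i (e u) (a i) ↔ M.Anc i u (w i) ∧ u ≠ w i
  lf : ∀ x, M'.lf x = e (M.lf x)
  ret : M'.ret.card ≤ M.ret.card

theorem Good.sub1 {M : Sys α} {X : Finset α} (h : M.Good X ∅) (hr : M.ret = ∅) {w : M.V}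
    (hw : w ≠ M.ρ) : ∃ (M' : Sys α) (a : Bool → M'.V) (e : M.V → M'.V),
      SubOK M X (fun _ => w) M' a e ∧ a true = a false := by
  have hp : ∀ j, M.par j w = M.par true w := by
    have : M.par true w = M.par false w := by
      by_contra hc
      have : w ∈ M.ret := Finset.mem_filter.2 ⟨Finset.mem_univ _, hw, hc⟩
      simp [hr] at this
    rintro (_ | _)
    · exact this.symm
    · rfl
  refine ⟨M.sub true w, fun _ => none, some, ⟨h.sub hw _ ⟨true, rfl⟩ (by simp), ?_, ?_, ?_, ?_, ?_, ?_, ?_,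
    sub_ret⟩, rfl⟩
  · intro _ h; cases h
  · intro _; exact ⟨true, some w, sub_ch_some.2 ⟨hw, by rw [if_pos ⟨rfl, rfl⟩]⟩⟩
  · intro v hv h; exact hv (Option.some_injective _ h)
  · intro j u v; exact sub_anc hw
  · intro j v; exact sub_none_anc hw (hp j)
  · intro j u; exact (sub_anc_none hw).trans (by rw [← hp j]; exact h.anc_par hw)
  · intro x; rfl

theorem Good.sub2 {M : Sys α} {X : Finset α} (h : M.Good X ∅) {w : Bool → M.V}
    (hw : ∀ i, w i ≠ M.ρ) : ∃ (M' : Sys α) (a : Bool → M'.V) (e : M.V → M'.V),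
      SubOK M X w M' a e ∧ a true ≠ a false := by
  have h1 : (M.sub true (w true)).Good X {none} := h.sub (hw true) _ rfl (by simp)
  have hw2 : (some (w false) : (M.sub true (w true)).V) ≠ (M.sub true (w true)).ρ :=
    fun h => hw false (Option.some_injective _ h)
  have hn1 : (none : (M.sub true (w true)).V) ≠ (M.sub true (w true)).ρ := fun h => by cases h
  refine ⟨(M.sub true (w true)).sub false (some (w false)),
    fun i => if i then some none else none, fun v => some (some v),
    ⟨h1.sub hw2 _ ⟨false, rfl⟩ ?_, ?_, ?_, ?_, ?_, ?_, ?_, ?_, sub_ret.trans sub_ret⟩, ?_⟩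
  · rintro v rfl; exact ⟨true, rfl⟩
  · rintro (_ | _) h
    · cases h
    · cases h
  · rintro (_ | _)
    · exact ⟨false, some (some (w false)), sub_ch_some.2 ⟨hw2, by rw [if_pos ⟨rfl, rfl⟩]; rfl⟩⟩
    · have : (M.sub true (w true)).Ch true none (some (w true)) :=
        sub_ch_some.2 ⟨hw true, by rw [if_pos ⟨rfl, rfl⟩]⟩
      obtain ⟨c, hc, _⟩ := sub_ch_exists (i := false) (w := (some (w false) : (M.sub true (w true)).V)) this
      exact ⟨true, c, hc⟩
  · intro v hv h; exact hv (Option.some_injective _ (Option.some_injective _ h))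
  · intro j u v
    exact (sub_anc hw2).trans (sub_anc (hw true))
  · rintro (_ | _) v
    · exact (sub_none_anc hw2 rfl).trans (sub_anc (hw true))
    · exact (sub_anc hw2).trans (sub_none_anc (hw true) rfl)
  · rintro (_ | _) u
    · refine (sub_anc_none hw2).trans ((h1.anc_par hw2).trans (and_congr (sub_anc (hw true)) ?_))
      exact not_congr ⟨fun h => Option.some_injective _ h, fun h => congrArg some h⟩
    · refine (sub_anc hw2).trans ((sub_anc_none (hw true)).trans (h.anc_par (hw true)))
  · intro x; rfl
  · intro h; cases h

end Sys
end

section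
set_option linter.unusedSectionVars false
namespace Sys

/-- hang the system `M` below `a i` in tree `i` -/
noncomputable def hang (N M : Sys α) (S : Finset α) (a : Bool → N.V) : Sys α where
  V := N.V ⊕ M.V
  fin := inferInstance
  ρ := .inl N.ρ
  par := fun i v => match v with
    | .inl v => .inl (N.par i v)
    | .inr m => if m = M.ρ then .inl (a i) else .inr (M.par i m)
  lf := fun x => if x ∈ S then .inr (M.lf x) else .inl (N.lf x)
  rk := fun v => match v with
    | .inl v => N.rk v
    | .inr m => M.rk m - M.rk M.ρ + 1 + max (N.rk (a true)) (N.rk (a false))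

section hang
variable {N M : Sys α} {S Y : Finset α} {F : Set M.V} {G : Set N.V} {a : Bool → N.V} {i : Bool}

theorem hang_ch_inl {x : N.V ⊕ M.V} {v : N.V} :
    (hang N M S a).Ch i x (.inl v) ↔ v ≠ N.ρ ∧ .inl (N.par i v) = x :=
  ⟨fun ⟨h1, h⟩ => ⟨fun h2 => h1 (by rw [h2]; rfl), h⟩,
    fun ⟨h1, h⟩ => ⟨fun h2 => h1 (Sum.inl_injective h2), h⟩⟩

theorem hang_ch_inr {x : N.V ⊕ M.V} {m : M.V} : (hang N M S a).Ch i x (.inr m) ↔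
    (if m = M.ρ then .inl (a i) else .inr (M.par i m)) = x :=
  ⟨fun h => h.2, fun h => ⟨fun h2 => Sum.inr_ne_inl h2, h⟩⟩

theorem hang_ll_lift {u v : N.V} (h : N.Anc i u v) : (hang N M S a).Anc i (.inl u) (.inl v) := by
  induction h with
  | refl => exact .refl
  | @tail b c _ hbc ih => exact ih.tail (hang_ch_inl.2 ⟨hbc.1, by rw [hbc.2]⟩)

theorem hang_rr_lift {u v : M.V} (h : M.Anc i u v) : (hang N M S a).Anc i (.inr u) (.inr v) := by
  induction h with
  | refl => exact .refl
  | @tail b c _ hbc ih => exact ih.tail (hang_ch_inr.2 (by rw [if_neg hbc.1, hbc.2]))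

theorem hang_l_desc {u : N.V} {b : N.V ⊕ M.V} (h : (hang N M S a).Anc i (.inl u) b) :
    N.Anc i u (Sum.elim id (fun _ => a i) b) := by
  induction h with
  | refl => exact .refl
  | @tail b c _ hbc ih =>
    match c, hbc with
    | .inl c, hbc =>
      obtain ⟨h1, rfl⟩ := hang_ch_inl.1 hbc
      exact Relation.ReflTransGen.tail ih ⟨h1, rfl⟩
    | .inr c, hbc =>
      rw [hang_ch_inr] at hbc
      split_ifs at hbc with h1
      · subst hbc; exact ih
      · subst hbc; exact ih

theorem hang_r_desc {u : M.V} {b : N.V ⊕ M.V} (h : (hang N M S a).Anc i (.inr u) b) :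
    Sum.elim (fun _ => False) (fun m => M.Anc i u m) b := by
  induction h with
  | refl => exact Relation.ReflTransGen.refl
  | @tail b c _ hbc ih =>
    match c, hbc with
    | .inl c, hbc =>
      obtain ⟨h1, rfl⟩ := hang_ch_inl.1 hbc
      exact ih
    | .inr c, hbc =>
      rw [hang_ch_inr] at hbc
      split_ifs at hbc with h1
      · subst hbc; exact ih.elim
      · subst hbc; exact Relation.ReflTransGen.tail ih ⟨h1, rfl⟩

theorem hang_ll {u v : N.V} : (hang N M S a).Anc i (.inl u) (.inl v) ↔ N.Anc i u v :=
  ⟨fun h => hang_l_desc h, hang_ll_lift⟩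

theorem hang_rr {u v : M.V} : (hang N M S a).Anc i (.inr u) (.inr v) ↔ M.Anc i u v :=
  ⟨fun h => hang_r_desc h, hang_rr_lift⟩

theorem hang_rl {u : M.V} {v : N.V} : ¬ (hang N M S a).Anc i (.inr u) (.inl v) :=
  fun h => hang_r_desc h

theorem hang_lr (hM : M.Good S F) {u : N.V} {m : M.V} :
    (hang N M S a).Anc i (.inl u) (.inr m) ↔ N.Anc i u (a i) := by
  refine ⟨fun h => hang_l_desc h, fun h => ?_⟩
  have h1 : (hang N M S a).Ch i (.inl (a i)) (.inr M.ρ) := hang_ch_inr.2 (by rw [if_pos rfl])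
  exact ((hang_ll_lift h).tail h1).trans (hang_rr_lift (hM.anc_root i m))

theorem Good.hang (hN : N.Good Y {v | ∃ i, v = a i}) (hM : M.Good S ∅) (hd : Disjoint Y S)
    (hch : ∀ i, ∃ j c, N.Ch j (a i) c) (h1 : a true = a false → ∀ i c, ¬ M.Ch i M.ρ c)
    (h2 : a true ≠ a false → ∃ i c, M.Ch i M.ρ c) : (hang N M S a).Good (Y ∪ S) ∅ := by
  have lfS : ∀ x ∈ S, (Sys.hang N M S a).lf x = .inr (M.lf x) := fun x hx => if_pos hx
  have lfY : ∀ x ∈ Y, (Sys.hang N M S a).lf x = .inl (N.lf x) :=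
    fun x hx => if_neg (Finset.disjoint_left.1 hd hx)
  have chl : ∀ {i v c}, N.Ch i v c → (Sys.hang N M S a).Ch i (.inl v) (.inl c) :=
    fun h => hang_ch_inl.2 ⟨h.1, by rw [h.2]⟩
  have chr : ∀ {i v c}, M.Ch i v c → (Sys.hang N M S a).Ch i (.inr v) (.inr c) :=
    fun h => hang_ch_inr.2 (by rw [if_neg h.1, h.2])
  have cha : ∀ i, (Sys.hang N M S a).Ch i (.inl (a i)) (.inr M.ρ) :=
    fun i => hang_ch_inr.2 (by rw [if_pos rfl])
  constructor
  · intro i v hv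
    match v, hv with
    | .inl v, hv => exact hN.rk_lt i v fun h => hv (by rw [h]; rfl)
    | .inr m, _ =>
      by_cases hm : m = M.ρ
      · have e : (Sys.hang N M S a).par i (.inr m) = .inl (a i) := if_pos hm
        rw [e, hm]
        show N.rk (a i) < M.rk M.ρ - M.rk M.ρ + 1 + max (N.rk (a true)) (N.rk (a false))
        have h3 := le_max_left (N.rk (a true)) (N.rk (a false))
        have h4 := le_max_right (N.rk (a true)) (N.rk (a false))
        cases i <;> linarith
      · have e : (Sys.hang N M S a).par i (.inr m) = .inr (M.par i m) := if_neg hm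
        rw [e]
        have := hM.rk_lt i m hm
        show M.rk (M.par i m) - M.rk M.ρ + 1 + max (N.rk (a true)) (N.rk (a false)) <
          M.rk m - M.rk M.ρ + 1 + max (N.rk (a true)) (N.rk (a false))
        linarith
  · intro x hx y hy hxy
    rcases Finset.mem_union.1 hx with hx | hx <;> rcases Finset.mem_union.1 hy with hy | hy
    · rw [lfY x hx, lfY y hy] at hxy
      exact hN.inj x hx y hy (Sum.inl_injective hxy)
    · rw [lfY x hx, lfS y hy] at hxy; cases hxy
    · rw [lfS x hx, lfY y hy] at hxy; cases hxy
    · rw [lfS x hx, lfS y hy] at hxy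
      exact hM.inj x hx y hy (Sum.inr_injective hxy)
  · intro v
    match v with
    | .inl v =>
      have key : (∃ x ∈ Y ∪ S, (Sys.hang N M S a).lf x = .inl v) ↔ ∃ x ∈ Y, N.lf x = v := by
        constructor
        · rintro ⟨x, hx, e⟩
          rcases Finset.mem_union.1 hx with hx | hx
          · rw [lfY x hx] at e; exact ⟨x, hx, Sum.inl_injective e⟩
          · rw [lfS x hx] at e; cases e
        · rintro ⟨x, hx, rfl⟩
          exact ⟨x, Finset.mem_union_left _ hx, lfY x hx⟩
      rw [key, ← hN.leaf]
      constructor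
      · intro h i c hc; exact h i _ (chl hc)
      · intro h i c hc
        match c, hc with
        | .inl c, hc =>
          rw [hang_ch_inl] at hc
          exact h i c ⟨hc.1, Sum.inl_injective hc.2⟩
        | .inr c, hc =>
          rw [hang_ch_inr] at hc
          split_ifs at hc
          obtain ⟨j, d, hd⟩ := hch i
          rw [Sum.inl_injective hc] at hd
          exact h j d hd
    | .inr v =>
      have key : (∃ x ∈ Y ∪ S, (Sys.hang N M S a).lf x = .inr v) ↔ ∃ x ∈ S, M.lf x = v := by
        constructor
        · rintro ⟨x, hx, e⟩
          rcases Finset.mem_union.1 hx with hx | hx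
          · rw [lfY x hx] at e; cases e
          · rw [lfS x hx] at e; exact ⟨x, hx, Sum.inr_injective e⟩
        · rintro ⟨x, hx, rfl⟩
          exact ⟨x, Finset.mem_union_right _ hx, lfS x hx⟩
      rw [key, ← hM.leaf]
      constructor
      · intro h i c hc; exact h i _ (chr hc)
      · intro h i c hc
        match c, hc with
        | .inl c, hc =>
          rw [hang_ch_inl] at hc
          cases hc.2
        | .inr c, hc =>
          rw [hang_ch_inr] at hc
          split_ifs at hc with h3
          exact h i c ⟨h3, Sum.inr_injective hc⟩
  · intro x hx
    rcases Finset.mem_union.1 hx with hx | hx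
    · rw [lfY x hx]
      exact congrArg Sum.inl (hN.leafpar x hx)
    · rw [lfS x hx]
      by_cases hm : M.lf x = M.ρ
      · have e : ∀ i, (Sys.hang N M S a).par i (.inr (M.lf x)) = .inl (a i) := fun _ => if_pos hm
        rw [e, e]
        by_contra hne
        obtain ⟨i, c, hc⟩ := h2 fun h => hne (congrArg _ h)
        exact (hM.leaf _).2 ⟨x, hx, hm⟩ i c hc
      · have e : ∀ i, (Sys.hang N M S a).par i (.inr (M.lf x)) = .inr (M.par i (M.lf x)) :=
          fun _ => if_neg hm
        rw [e, e, hM.leafpar x hx]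
  · intro v hv _ hp hex
    match v, hv, hp, hex with
    | .inl v, hv, hp, hex =>
      by_cases hva : ∃ i, v = a i
      · obtain ⟨i, rfl⟩ := hva
        obtain ⟨j, c, hc⟩ := hch i
        exact ⟨i, _, j, _, Sum.inr_ne_inl, cha i, chl hc⟩
      · have hex' : ∃ i c, N.Ch i v c := by
          obtain ⟨i, c, hc⟩ := hex
          match c, hc with
          | .inl c, hc =>
            rw [hang_ch_inl] at hc
            exact ⟨i, c, hc.1, Sum.inl_injective hc.2⟩
          | .inr c, hc =>
            rw [hang_ch_inr] at hc
            split_ifs at hc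
            exact absurd ⟨i, (Sum.inl_injective hc).symm⟩ hva
        obtain ⟨i, c, j, d, hcd, hc, hd⟩ := hN.deg v (fun h => hv (by rw [h]; rfl)) hva
          (Sum.inl_injective hp) hex'
        exact ⟨i, _, j, _, fun h => hcd (Sum.inl_injective h), chl hc, chl hd⟩
    | .inr v, hv, hp, hex =>
      obtain ⟨i, c, hc⟩ := hex
      have hex' : ∃ i c, M.Ch i v c := by
        match c, hc with
        | .inl c, hc =>
          rw [hang_ch_inl] at hc
          cases hc.2
        | .inr c, hc =>
          rw [hang_ch_inr] at hc
          split_ifs at hc with h3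
          exact ⟨i, c, h3, Sum.inr_injective hc⟩
      by_cases hm : v = M.ρ
      · have e : ∀ i, (Sys.hang N M S a).par i (.inr v) = .inl (a i) := fun _ => if_pos hm
        rw [e, e] at hp
        obtain ⟨i, c, hc⟩ := hex'
        rw [hm] at hc
        exact absurd hc (h1 (Sum.inl_injective hp) i c)
      · have e : ∀ i, (Sys.hang N M S a).par i (.inr v) = .inr (M.par i v) :=
          fun _ => if_neg hm
        rw [e, e] at hp
        obtain ⟨i, c, j, d, hcd, hc, hd⟩ := hM.deg v hm (by simp) (Sum.inr_injective hp) hex'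
        exact ⟨i, _, j, _, fun h => hcd (Sum.inr_injective h), chr hc, chr hd⟩

theorem hang_ret (hr : M.ret = ∅) :
    (hang N M S a).ret.card ≤ N.ret.card + if a true = a false then 0 else 1 := by
  have : (hang N M S a).ret ⊆ N.ret.map ⟨Sum.inl, Sum.inl_injective⟩ ∪
      (if a true = a false then ∅ else {.inr M.ρ}) := by
    intro v hv
    have hv2 := (Finset.mem_filter.1 hv).2
    refine Finset.mem_union.2 ?_
    match v, hv2 with
    | .inl v, hv2 =>
      refine Or.inl (Finset.mem_map.2 ⟨v, Finset.mem_filter.2 ⟨Finset.mem_univ _, ?_, ?_⟩, rfl⟩)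
      · rintro rfl; exact hv2.1 rfl
      · intro hp
        exact hv2.2 (congrArg Sum.inl hp)
    | .inr m, hv2 =>
      right
      by_cases hm : m = M.ρ
      · have e : ∀ i, (Sys.hang N M S a).par i (.inr m) = .inl (a i) := fun _ => if_pos hm
        rw [e, e] at hv2
        rw [if_neg fun h => hv2.2 (congrArg _ h), hm]
        exact Finset.mem_singleton_self _
      · exfalso
        have e : ∀ i, (Sys.hang N M S a).par i (.inr m) = .inr (M.par i m) :=
          fun _ => if_neg hm
        rw [e, e] at hv2
        have : m ∈ M.ret := Finset.mem_filter.2 ⟨Finset.mem_univ _, hm, fun h => hv2.2 (congrArg _ h)⟩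
        simp [hr] at this
  refine (Finset.card_le_card this).trans ((Finset.card_union_le _ _).trans ?_)
  rw [Finset.card_map]
  split_ifs
  · simp
  · exact Nat.add_le_add_left (Finset.card_singleton _).le _

end hang

/-- one vertex -/
def one (x : α) : Sys α where
  V := Unit
  fin := inferInstance
  ρ := ()
  par := fun _ _ => ()
  lf := fun _ => ()
  rk := fun _ => 0

theorem one_ch {x : α} {i : Bool} {u v} : ¬ (one x).Ch i u v := fun h => h.1 rfl

theorem one_good (x : α) : (one x).Good {x} ∅ where
  rk_lt := fun _ _ h => absurd rfl h
  inj := by simp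
  leaf := fun v => ⟨fun _ => ⟨x, by simp, rfl⟩, fun _ _ _ => one_ch⟩
  leafpar := fun _ _ => rfl
  deg := fun _ h => absurd rfl h

theorem one_ret (x : α) : (one x).ret = ∅ := by
  unfold ret
  exact Finset.filter_false_of_mem fun v _ h => h.1 rfl

/-- one edge -/
def two (x : α) : Sys α where
  V := Bool
  fin := inferInstance
  ρ := false
  par := fun _ _ => false
  lf := fun _ => true
  rk := fun b => if b then 1 else 0

theorem two_good (x : α) : (two x).Good {x} ∅ where
  rk_lt := by
    intro i v hv
    cases v
    · exact absurd rfl hv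
    · show (0 : ℚ) < 1
      norm_num
  inj := by simp
  leaf := by
    intro v
    cases v
    · constructor
      · intro h; exact absurd ⟨by simp [two], rfl⟩ (h true true)
      · rintro ⟨_, _, h⟩; cases h
    · exact ⟨fun _ => ⟨x, by simp, rfl⟩, fun _ i c h => by cases h.2⟩
  leafpar := fun _ _ => rfl
  deg := by
    rintro v hv _ _ ⟨i, c, hc⟩
    exact absurd hc.2.symm hv

theorem two_ret (x : α) : (two x).ret = ∅ := by
  unfold ret
  exact Finset.filter_false_of_mem fun v _ h => h.2 rfl

end Sys
end

section
set_option linter.unusedSectionVars false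
namespace Sys

def Rep (M : Sys α) (X : Finset α) (i : Bool) (C : Finset α) : Prop :=
  ∃ w, w ≠ M.ρ ∧ ∀ x ∈ X, M.Anc i w (M.lf x) ↔ x ∈ C

theorem insert_rep {N N' M : Sys α} {Y S D : Finset α} {w : Bool → N.V} {a : Bool → N'.V}
    {e : N.V → N'.V} {𝒞 : Set (Finset α)} {i : Bool}
    (hs : SubOK N Y w N' a e) (hM : M.Good S ∅)
    (hd : Disjoint Y S) (hS : S.Nonempty) (hpc : PairwiseCompatible 𝒞)
    (hsub : ∀ C ∈ 𝒞, C ⊆ Y ∪ S) (hne : ∀ C ∈ 𝒞, C.Nonempty) (hun : Unseparated 𝒞 S)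
    (hD : D ∈ 𝒞) (hDS : S ⊆ D) (hDne : (D \ S).Nonempty)
    (hmin : ∀ C ∈ 𝒞, S ⊆ C → (C \ S).Nonempty → D ⊆ C)
    (hw : ∀ x ∈ Y, N.Anc i (w i) (N.lf x) ↔ x ∈ D \ S) (hwρ : w i ≠ N.ρ)
    (hrep : ∀ C ∈ 𝒞, (C \ S).Nonempty → Rep N Y i (C \ S))
    (hMrep : ∀ C ∈ 𝒞, C ⊆ S → ∃ m, ∀ x ∈ S, M.Anc i m (M.lf x) ↔ x ∈ C) :
    ∀ C ∈ 𝒞, Rep (hang N' M S a) (Y ∪ S) i C := by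
  have lfS : ∀ x ∈ S, (Sys.hang N' M S a).lf x = .inr (M.lf x) := fun x hx => if_pos hx
  have lfY : ∀ x ∈ Y, (Sys.hang N' M S a).lf x = .inl (e (N.lf x)) :=
    fun x hx => (if_neg (Finset.disjoint_left.1 hd hx)).trans (by rw [hs.lf])
  have hDY : ∀ y ∈ D \ S, y ∈ Y := by
    intro y hy
    rw [Finset.mem_sdiff] at hy
    exact (Finset.mem_union.1 (hsub D hD hy.1)).resolve_right hy.2
  -- a vertex of N, taken over
  have old : ∀ C ∈ 𝒞, ∀ u, u ≠ N.ρ → (∀ x ∈ Y, N.Anc i u (N.lf x) ↔ x ∈ C \ S) →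
      ((∀ x ∈ S, (N.Anc i u (w i) ∧ u ≠ w i ↔ x ∈ C))) → Rep (hang N' M S a) (Y ∪ S) i C := by
    intro C hC u huρ hu hu2
    refine ⟨.inl (e u), fun h => hs.eρ u huρ (Sum.inl_injective h), fun x hx => ?_⟩
    rcases Finset.mem_union.1 hx with hx | hx
    · rw [lfY x hx]
      refine hang_ll.trans ((hs.ee i u _).trans ((hu x hx).trans ?_))
      rw [Finset.mem_sdiff]
      exact ⟨fun h => h.1, fun h => ⟨h, Finset.disjoint_left.1 hd hx⟩⟩
    · rw [lfS x hx]
      exact (hang_lr hM).trans ((hs.ea i u).trans (hu2 x hx))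
  intro C hC
  by_cases hCS : C ⊆ S
  · obtain ⟨m, hm⟩ := hMrep C hC hCS
    refine ⟨.inr m, fun h => Sum.inr_ne_inl h, fun x hx => ?_⟩
    rcases Finset.mem_union.1 hx with hx | hx
    · rw [lfY x hx]
      exact ⟨fun h => absurd h hang_rl, fun h => absurd (hCS h) (Finset.disjoint_left.1 hd hx)⟩
    · rw [lfS x hx]
      exact hang_rr.trans (hm x hx)
  have hCne : (C \ S).Nonempty := by
    rw [Finset.sdiff_nonempty]; exact hCS
  obtain ⟨u, huρ, hu⟩ := hrep C hC hCne
  obtain ⟨y, hy⟩ := hDne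
  have hwy := (hw y (hDY y hy)).2 hy
  rcases hun C hC with h1 | h1 | h1
  · by_cases hCD : C = D \ S
    · refine old C hC (w i) hwρ ?_ ?_
      · intro x hx
        rw [hw x hx, hCD]
        simp
      · intro x hx
        refine ⟨fun h => absurd rfl h.2, fun h => ?_⟩
        exact absurd (Finset.mem_inter.2 ⟨h, hx⟩) (by rw [h1]; simp)
    · refine old C hC u huρ hu fun x hx => ⟨fun h => ?_, fun h => ?_⟩
      · exfalso
        have hsubC : D \ S ⊆ C := by
          intro z hz
          exact (Finset.mem_sdiff.1 ((hu z (hDY z hz)).1 (h.1.trans ((hw z (hDY z hz)).2 hz)))).1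
        rcases hpc C hC D hD with h2 | h2 | h2
        · have : y ∈ C ∩ D := Finset.mem_inter.2 ⟨hsubC hy, (Finset.mem_sdiff.1 hy).1⟩
          rw [h2] at this
          simp at this
        · refine hCD (Finset.Subset.antisymm (fun z hz => Finset.mem_sdiff.2 ⟨h2 hz, fun hzS => ?_⟩) hsubC)
          have : z ∈ C ∩ S := Finset.mem_inter.2 ⟨hz, hzS⟩
          rw [h1] at this
          simp at this
        · have : x ∈ C ∩ S := Finset.mem_inter.2 ⟨h2 (hDS hx), hx⟩
          rw [h1] at this
          simp at this
      · have : x ∈ C ∩ S := Finset.mem_inter.2 ⟨h, hx⟩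
        rw [h1] at this
        simp at this
  · exact absurd h1 hCS
  · have hDC := hmin C hC h1 hCne
    by_cases hCD : C = D
    · subst hCD
      refine ⟨.inl (a i), fun h => hs.aρ i (Sum.inl_injective h), fun x hx => ?_⟩
      rcases Finset.mem_union.1 hx with hx | hx
      · rw [lfY x hx]
        refine hang_ll.trans ((hs.ae i _).trans ((hw x hx).trans ?_))
        rw [Finset.mem_sdiff]
        exact ⟨fun h => h.1, fun h => ⟨h, Finset.disjoint_left.1 hd hx⟩⟩
      · rw [lfS x hx]
        exact (hang_lr hM).trans ⟨fun _ => h1 hx, fun _ => .refl⟩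
    · refine old C hC u huρ hu fun x hx => ⟨fun _ => h1 hx, fun _ => ?_⟩
      have huy : N.Anc i u (N.lf y) := (hu y (hDY y hy)).2
        (Finset.mem_sdiff.2 ⟨hDC (Finset.mem_sdiff.1 hy).1, (Finset.mem_sdiff.1 hy).2⟩)
      have hnot : ¬ N.Anc i (w i) u := by
        intro hwu
        refine hCD (Finset.Subset.antisymm (fun z hz => ?_) hDC)
        by_cases hzS : z ∈ S
        · exact hDS hzS
        · have hzY := (Finset.mem_union.1 (hsub C hC hz)).resolve_right hzS
          have := (hu z hzY).2 (Finset.mem_sdiff.2 ⟨hz, hzS⟩)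
          exact (Finset.mem_sdiff.1 ((hw z hzY).1 (hwu.trans this))).1
      refine ⟨(huy.comparable hwy).resolve_right hnot, ?_⟩
      rintro rfl
      exact hnot .refl

theorem exists_D {X S : Finset α} {𝒞 : Set (Finset α)} (hpc : PairwiseCompatible 𝒞) (hX : X ∈ 𝒞)
    (hSX : S ⊆ X) (hS : S.Nonempty) (hne : (X \ S).Nonempty) :
    ∃ D ∈ 𝒞, S ⊆ D ∧ (D \ S).Nonempty ∧ ∀ C ∈ 𝒞, S ⊆ C → (C \ S).Nonempty → D ⊆ C := by
  obtain ⟨D, hD, hmin⟩ := WellFounded.has_min (measure (Finset.card (α := α))).wf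
    {C | C ∈ 𝒞 ∧ S ⊆ C ∧ (C \ S).Nonempty} ⟨X, hX, hSX, hne⟩
  refine ⟨D, hD.1, hD.2.1, hD.2.2, fun C hC h1 h2 => ?_⟩
  have h3 : ¬ C.card < D.card := hmin C ⟨hC, h1, h2⟩
  rcases hpc D hD.1 C hC with h4 | h4 | h4
  · obtain ⟨s, hs⟩ := hS
    have : s ∈ D ∩ C := Finset.mem_inter.2 ⟨hD.2.1 hs, h1 hs⟩
    rw [h4] at this
    simp at this
  · exact h4
  · rw [Finset.eq_of_subset_of_card_le h4 (not_lt.1 h3)]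

theorem anc_congr {M : Sys α} (hr : M.ret = ∅) (i j : Bool) : M.Anc i = M.Anc j := by
  have hp : ∀ v, v ≠ M.ρ → M.par true v = M.par false v := by
    intro v hv
    by_contra hc
    have : v ∈ M.ret := Finset.mem_filter.2 ⟨Finset.mem_univ _, hv, hc⟩
    simp [hr] at this
  have key : M.Ch true = M.Ch false := by
    funext a b
    refine propext (and_congr_right fun hb => ?_)
    rw [hp b hb]
  unfold Anc
  cases i <;> cases j <;> simp [key]

theorem base_tree (n : ℕ) : ∀ (Y : Finset α) (𝒟 : Set (Finset α)), Y.card = n + 1 →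
    PairwiseCompatible 𝒟 → (∀ C ∈ 𝒟, C.Nonempty ∧ C ⊆ Y) → Y ∈ 𝒟 →
    ∃ M : Sys α, M.Good Y ∅ ∧ M.ret = ∅ ∧ ∀ i, ∀ C ∈ 𝒟, M.Rep Y i C := by
  induction n with
  | zero =>
    intro Y 𝒟 hc hpc hsub hY
    obtain ⟨x, rfl⟩ := Finset.card_eq_one.1 hc
    refine ⟨two x, two_good x, two_ret x, fun i C hC => ⟨true, by simp [two], fun y hy => ?_⟩⟩
    have hCx : C = {x} := (hsub C hC).1.subset_singleton_iff.1 (hsub C hC).2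
    rw [hCx]
    exact ⟨fun _ => hy, fun _ => .refl⟩
  | succ n ih =>
    intro Y 𝒟 hc hpc hsub hY
    obtain ⟨x, hx⟩ : Y.Nonempty := Finset.card_pos.1 (by omega)
    have hxY : ({x} : Finset α) ⊆ Y := Finset.singleton_subset_iff.2 hx
    have hc' : (Y \ {x}).card = n + 1 := by
      rw [Finset.card_sdiff_of_subset hxY, hc]; simp
    have hne : (Y \ {x}).Nonempty := Finset.card_pos.1 (by omega)
    obtain ⟨N, hN, hNr, hNrep⟩ := ih (Y \ {x}) (removeTaxa 𝒟 {x}) hc' (hpc.removeTaxa _)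
      (by
        rintro C ⟨h1, C', h2, rfl⟩
        exact ⟨h1, Finset.sdiff_subset_sdiff (hsub C' h2).2 le_rfl⟩) ⟨hne, Y, hY, rfl⟩
    obtain ⟨D, hD, hDS, hDne, hmin⟩ := exists_D hpc hY hxY (by simp) hne
    obtain ⟨w, hwρ, hw⟩ := hNrep true (D \ {x}) ⟨hDne, D, hD, rfl⟩
    obtain ⟨N', a, e, hs, haa⟩ := hN.sub1 hNr hwρ
    have hd : Disjoint (Y \ {x}) {x} := Finset.sdiff_disjoint
    have hU : Y \ {x} ∪ {x} = Y := Finset.sdiff_union_of_subset hxY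
    have hg := Good.hang hs.good (one_good x) hd hs.ach (fun _ _ _ => one_ch) (fun h => absurd haa h)
    rw [hU] at hg
    refine ⟨_, hg, ?_, ?_⟩
    · have h1 := hang_ret (N := N') (S := {x}) (a := a) (one_ret x)
      have h2 := hs.ret
      rw [if_pos haa] at h1
      rw [hNr, Finset.card_empty] at h2
      exact Finset.card_eq_zero.1 (by omega)
    · intro i
      have := insert_rep (i := i) hs (one_good x) hd (by simp) hpc
        (fun C hC => by rw [hU]; exact (hsub C hC).2) (fun C hC => (hsub C hC).1)
        (fun C hC => (isSTSet_singleton 𝒟 hx).2.1 C hC) hD hDS hDne hmin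
        (fun y hy => by rw [anc_congr hNr i true]; exact hw y hy) hwρ
        (fun C hC h => hNrep i _ ⟨h, C, hC, rfl⟩)
        (fun C hC hCx => ⟨(), fun y hy => by
          rw [(hsub C hC).1.subset_singleton_iff.1 hCx]
          exact ⟨fun _ => hy, fun _ => .refl⟩⟩)
      rwa [hU] at this

theorem base_tree' {Y : Finset α} {𝒟 : Set (Finset α)} (hY' : Y.Nonempty)
    (hpc : PairwiseCompatible 𝒟) (hsub : ∀ C ∈ 𝒟, C.Nonempty ∧ C ⊆ Y) (hY : Y ∈ 𝒟) :
    ∃ M : Sys α, M.Good Y ∅ ∧ M.ret = ∅ ∧ ∀ i, ∀ C ∈ 𝒟, M.Rep Y i C := by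
  have := Finset.card_pos.2 hY'
  exact base_tree (Y.card - 1) Y 𝒟 (by omega) hpc hsub hY

theorem upper (L : List (Finset α)) : ∀ (X : Finset α) (𝒞 : Bool → Set (Finset α)), X.Nonempty →
    (∀ i, PairwiseCompatible (𝒞 i)) → (∀ i, ∀ C ∈ 𝒞 i, C.Nonempty ∧ C ⊆ X) → (∀ i, X ∈ 𝒞 i) →
    IsSTTreeSeq X (𝒞 true ∪ 𝒞 false) L →
    ∃ M : Sys α, M.Good X ∅ ∧ M.ret.card ≤ L.length ∧ ∀ i, ∀ C ∈ 𝒞 i, M.Rep X i C := by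
  have hmem : ∀ (𝒞 : Bool → Set (Finset α)) i, ∀ C ∈ 𝒞 i, C ∈ 𝒞 true ∪ 𝒞 false := by
    rintro 𝒞 (_ | _) C hC
    · exact Or.inr hC
    · exact Or.inl hC
  have easy : ∀ (n : ℕ) (X : Finset α) (𝒞 : Bool → Set (Finset α)), X.Nonempty →
      (∀ i, ∀ C ∈ 𝒞 i, C.Nonempty ∧ C ⊆ X) → (∀ i, X ∈ 𝒞 i) →
      PairwiseCompatible (𝒞 true ∪ 𝒞 false) →
      ∃ M : Sys α, M.Good X ∅ ∧ M.ret.card ≤ n ∧ ∀ i, ∀ C ∈ 𝒞 i, M.Rep X i C := by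
    intro n X 𝒞 hX hsub hXm hpc
    obtain ⟨M, h1, h2, h3⟩ := base_tree' hX hpc
      (by rintro C (hC | hC) <;> exact hsub _ C hC) (Or.inl (hXm true))
    exact ⟨M, h1, by simp [h2], fun i C hC => h3 i C (hmem 𝒞 i C hC)⟩
  induction L with
  | nil =>
    intro X 𝒞 hX hpc hsub hXm hL
    exact easy _ X 𝒞 hX hsub hXm hL.2
  | cons S L ih =>
    intro X 𝒞 hX hpc hsub hXm hL
    obtain ⟨⟨hST, hL1⟩, hL2⟩ := hL
    by_cases hXS : X \ S = ∅
    · refine easy _ X 𝒞 hX hsub hXm ?_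
      have hE : S = X := Finset.Subset.antisymm hST.1 (Finset.sdiff_eq_empty_iff_subset.1 hXS)
      subst hE
      intro A hA B hB
      have : ∀ C ∈ 𝒞 true ∪ 𝒞 false, C ∈ restrictTo (𝒞 true ∪ 𝒞 false) S := by
        intro C hC
        have hC' : C.Nonempty ∧ C ⊆ S := by
          rcases hC with hC | hC <;> exact hsub _ C hC
        exact ⟨hC'.1, C, hC, (Finset.inter_eq_left.2 hC'.2).symm⟩
      exact hST.2.2 A (this A hA) B (this B hB)
    have hne : (X \ S).Nonempty := Finset.nonempty_iff_ne_empty.2 hXS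
    have hun : removeTaxa (𝒞 true ∪ 𝒞 false) S = removeTaxa (𝒞 true) S ∪ removeTaxa (𝒞 false) S := by
      ext D
      constructor
      · rintro ⟨h1, C, h2 | h2, h3⟩
        · exact Or.inl ⟨h1, C, h2, h3⟩
        · exact Or.inr ⟨h1, C, h2, h3⟩
      · rintro (⟨h1, C, h2, h3⟩ | ⟨h1, C, h2, h3⟩)
        · exact ⟨h1, C, Or.inl h2, h3⟩
        · exact ⟨h1, C, Or.inr h2, h3⟩
    have hL2' : PairwiseCompatible (removeAll (removeTaxa (𝒞 true ∪ 𝒞 false) S) L) := hL2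
    rw [hun] at hL1 hL2'
    obtain ⟨N, hN, hNr, hNrep⟩ := ih (X \ S) (fun i => removeTaxa (𝒞 i) S) hne
      (fun i => (hpc i).removeTaxa S)
      (by
        rintro i C ⟨h1, C', h2, rfl⟩
        exact ⟨h1, Finset.sdiff_subset_sdiff (hsub i C' h2).2 le_rfl⟩)
      (fun i => ⟨hne, X, hXm i, rfl⟩) ⟨hL1, hL2'⟩
    by_cases hS0 : S = ∅
    · subst hS0
      rw [Finset.sdiff_empty] at hN hNrep
      refine ⟨N, hN, hNr.trans (by simp), fun i C hC => hNrep i C ⟨(hsub i C hC).1, C, hC, by simp⟩⟩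
    have hS : S.Nonempty := Finset.nonempty_iff_ne_empty.2 hS0
    have hXS' : S ∈ restrictTo (𝒞 true ∪ 𝒞 false) S :=
      ⟨hS, X, Or.inl (hXm true), (Finset.inter_eq_right.2 hST.1).symm⟩
    obtain ⟨M, hM, hMr, hMrep⟩ := base_tree' hS hST.2.2
      (by rintro C ⟨h1, C', _, rfl⟩; exact ⟨h1, Finset.inter_subset_right⟩) hXS'
    have hMρ : ∃ i c, M.Ch i M.ρ c := by
      obtain ⟨w, hw, _⟩ := hMrep true S hXS'
      rcases Relation.ReflTransGen.cases_head (hM.anc_root true w) with h | ⟨c, h, _⟩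
      · exact absurd h.symm hw
      · exact ⟨true, c, h⟩
    have hDex := fun i => exists_D (hpc i) (hXm i) hST.1 hS hne
    choose D hD hDS hDne hmin using hDex
    choose w hwρ hw using fun i => hNrep i (D i \ S) ⟨hDne i, D i, hD i, rfl⟩
    obtain ⟨N', a, e, hs, haa⟩ := hN.sub2 hwρ
    have hd : Disjoint (X \ S) S := Finset.sdiff_disjoint
    have hU : X \ S ∪ S = X := Finset.sdiff_union_of_subset hST.1
    have hg := Good.hang hs.good hM hd hs.ach (fun h => absurd h haa) (fun _ => hMρ)
    rw [hU] at hg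
    refine ⟨_, hg, ?_, ?_⟩
    · have h1 := hang_ret (N := N') (S := S) (a := a) hMr
      have h2 := hs.ret
      rw [if_neg haa] at h1
      rw [List.length_cons]
      omega
    · intro i
      have := insert_rep (i := i) hs hM hd hS (hpc i)
        (fun C hC => by rw [hU]; exact (hsub i C hC).2) (fun C hC => (hsub i C hC).1)
        (fun C hC => hST.2.1 C (hmem 𝒞 i C hC)) (hD i) (hDS i) (hDne i) (hmin i)
        (hw i) (hwρ i)
        (fun C hC h => hNrep i _ ⟨h, C, hC, rfl⟩)
        (fun C hC hCS => by
          obtain ⟨m, _, hm⟩ := hMrep i C ⟨(hsub i C hC).1, C, hmem 𝒞 i C hC,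
            (Finset.inter_eq_left.2 hCS).symm⟩
          exact ⟨m, hm⟩)
      rwa [hU] at this

end Sys

theorem stSeq_addX (L : List (Finset α)) : ∀ (X : Finset α) (𝒞 𝒞' : Set (Finset α)),
    (∀ C ∈ 𝒞, C ⊆ X) → (∀ C ∈ 𝒞', C ∈ 𝒞 ∨ C = X) → IsSTTreeSeq X 𝒞 L → IsSTTreeSeq X 𝒞' L := by
  induction L with
  | nil =>
    intro X 𝒞 𝒞' hsub h hL
    refine ⟨trivial, ?_⟩
    have h2 : PairwiseCompatible 𝒞 := hL.2
    show PairwiseCompatible 𝒞'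
    intro A hA B hB
    have hs : ∀ C ∈ 𝒞', C ⊆ X := by
      intro C hC
      rcases h C hC with h1 | rfl
      · exact hsub C h1
      · exact le_rfl
    rcases h A hA with h3 | rfl
    · rcases h B hB with h4 | rfl
      · exact h2 A h3 B h4
      · exact Or.inr (Or.inl (hs A hA))
    · exact Or.inr (Or.inr (hs B hB))
  | cons S L ih =>
    intro X 𝒞 𝒞' hsub h hL
    obtain ⟨⟨hST, hL1⟩, hL2⟩ := hL
    have key := ih (X \ S) (removeTaxa 𝒞 S) (removeTaxa 𝒞' S)
      (by
        rintro C ⟨_, C', h2, rfl⟩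
        exact Finset.sdiff_subset_sdiff (hsub C' h2) le_rfl)
      (by
        rintro C ⟨h1, C', h2, rfl⟩
        rcases h C' h2 with h3 | rfl
        · exact Or.inl ⟨h1, C', h3, rfl⟩
        · exact Or.inr rfl) ⟨hL1, hL2⟩
    refine ⟨⟨⟨hST.1, ?_, ?_⟩, key.1⟩, key.2⟩
    · intro C hC
      rcases h C hC with h3 | rfl
      · exact hST.2.1 C h3
      · exact Or.inr (Or.inr hST.1)
    · rintro A ⟨hA, A', hA', rfl⟩ B ⟨hB, B', hB', rfl⟩
      rcases h A' hA' with h3 | rfl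
      · rcases h B' hB' with h4 | rfl
        · exact hST.2.2 _ ⟨hA, A', h3, rfl⟩ _ ⟨hB, B', h4, rfl⟩
        · rw [Finset.inter_eq_right.2 hST.1]
          exact Or.inr (Or.inl Finset.inter_subset_right)
      · rw [Finset.inter_eq_right.2 hST.1]
        exact Or.inr (Or.inr Finset.inter_subset_right)

theorem maxSeq_seq (L : List (Finset α)) : ∀ (X : Finset α) (𝒞 : Set (Finset α)),
    IsMaxSTSeq X 𝒞 L → IsSTSeq X 𝒞 L := by
  induction L with
  | nil => intro _ _ _; trivial
  | cons S L ih => intro X 𝒞 h; exact ⟨h.1.1, ih _ _ h.2⟩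

theorem upper_bound {X : Finset α} {T₁ T₂ : Net α} (h₁ : IsPhyloTree X T₁) (h₂ : IsPhyloTree X T₂)
    {L : List (Finset α)} (hL : IsSTTreeSeq X (clSet T₁ ∪ clSet T₂) L) :
    ∃ N : Net α, IsPhyloNet X N ∧ RepresentsSet X N (clSet T₁ ∪ clSet T₂) ∧
      N.reticNum ≤ L.length := by
  have hX : X.Nonempty := phylo_nonempty h₁.1
  obtain ⟨x0, hx0⟩ := hX
  have hs1 := clSet_nonempty_subset h₁.1
  have hs2 := clSet_nonempty_subset h₂.1
  have ins : ∀ 𝒞 : Set (Finset α), PairwiseCompatible 𝒞 → (∀ C ∈ 𝒞, C.Nonempty ∧ C ⊆ X) →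
      PairwiseCompatible (insert X 𝒞) ∧ ∀ C ∈ insert X 𝒞, C.Nonempty ∧ C ⊆ X := by
    intro 𝒞 h h'
    have h3 : ∀ C ∈ insert X 𝒞, C.Nonempty ∧ C ⊆ X := by
      rintro C (rfl | hC)
      · exact ⟨⟨x0, hx0⟩, le_rfl⟩
      · exact h' C hC
    refine ⟨?_, h3⟩
    rintro A (rfl | hA) B hB
    · exact Or.inr (Or.inr (h3 B hB).2)
    · rcases hB with rfl | hB
      · exact Or.inr (Or.inl (h' A hA).2)
      · exact h A hA B hB
  have i1 := ins _ (clSet_compatible h₁) hs1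
  have i2 := ins _ (clSet_compatible h₂) hs2
  obtain ⟨M, hM, hMr, hMrep⟩ := Sys.upper L X
    (fun i => if i then insert X (clSet T₁) else insert X (clSet T₂)) ⟨x0, hx0⟩
    (by rintro (_ | _); exacts [i2.1, i1.1]) (by rintro (_ | _); exacts [i2.2, i1.2])
    (by rintro (_ | _) <;> exact Or.inl rfl)
    (stSeq_addX L X _ _ (by rintro C (hC | hC); exacts [(hs1 C hC).2, (hs2 C hC).2])
      (by
        rintro C ((hC | hC) | (hC | hC))
        · exact Or.inr hC
        · exact Or.inl (Or.inl hC)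
        · exact Or.inr hC
        · exact Or.inl (Or.inr hC)) hL)
  refine ⟨M.net X x0, hM.net_phylo x0, ?_, (Sys.net_retic M X x0).trans hMr⟩
  have fin : ∀ i C, C.Nonempty → C ⊆ X → M.Rep X i C → RepresentsCluster X (M.net X x0) C := by
    rintro i C hC hCX ⟨w, hw, hr⟩
    have : M.cl X i w = C := by
      ext x
      rw [Sys.mem_cl]
      exact ⟨fun h => (hr x h.1).1 h.2, fun h => ⟨hCX h, (hr x (hCX h)).2 h⟩⟩
    rw [← this]
    exact hM.represents x0 hw (this ▸ hC)
  rintro C (hC | hC)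
  · exact fin true C (hs1 C hC).1 (hs1 C hC).2 (hMrep true C (Or.inr hC))
  · exact fin false C (hs2 C hC).1 (hs2 C hC).2 (hMrep false C (Or.inr hC))
end

/-- For clusters obtained from two (not necessarily binary) rooted
phylogenetic trees on `X`, the reticulation number equals the MST lower bound. -/
theorem rNum_eq_mstLB_two_trees {α : Type} [DecidableEq α] (X : Finset α)
    (T₁ T₂ : Net α) (h₁ : IsPhyloTree X T₁) (h₂ : IsPhyloTree X T₂) :
    rNum X (clSet T₁ ∪ clSet T₂) = mstLB X (clSet T₁ ∪ clSet T₂) := by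
  have hne := exists_STTreeSeq X.card X (clSet T₁ ∪ clSet T₂) rfl (by
    rintro C (hC | hC)
    · exact clSet_nonempty_subset h₁.1 C hC
    · exact clSet_nonempty_subset h₂.1 C hC)
  obtain ⟨L0, hL0⟩ := hne
  obtain ⟨L1, hL1, _⟩ := maxify L0.length L0 X (clSet T₁ ∪ clSet T₂) rfl hL0
  apply le_antisymm
  · obtain ⟨L, hL, hLl⟩ := Nat.sInf_mem (s := {p | ∃ L, IsMaxSTTreeSeq X (clSet T₁ ∪ clSet T₂) L ∧
      L.length = p}) ⟨_, L1, hL1, rfl⟩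
    obtain ⟨N, hN, hrep, hr⟩ := upper_bound h₁ h₂ ⟨maxSeq_seq L X _ hL.1, hL.2⟩
    have h3 : rNum X (clSet T₁ ∪ clSet T₂) ≤ N.reticNum := Nat.sInf_le ⟨N, hN, hrep, rfl⟩
    have h4 : L.length = mstLB X (clSet T₁ ∪ clSet T₂) := hLl
    omega
  · obtain ⟨N0, hN0, hrep0, _⟩ := upper_bound h₁ h₂ hL0
    obtain ⟨N, hN, hrep, hr⟩ := Nat.sInf_mem (s := {k | ∃ N : Net α, IsPhyloNet X N ∧
      RepresentsSet X N (clSet T₁ ∪ clSet T₂) ∧ N.reticNum = k}) ⟨_, N0, hN0, hrep0, rfl⟩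
    have h4 : N.reticNum = rNum X (clSet T₁ ∪ clSet T₂) := hr
    exact (lower_bound hN hrep).trans h4.le

end Phylo
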